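/- arXiv:2405.20999 — 7 statements merged into one kernel-verified Lean document; each statement's English description precedes it below -/
import Mathlib

section
/- For every Turing machine T there exist a finite alphabet A, a generalized shift φ on A, and an injective map ψ : Q × 𝒜 → A^ℤ such that φ(ψ(c)) = ψ(Δ(c)) for every configuration c whose state is not q_halt. That is, every Turing machine is conjugate to a generalized shift. -/
/-- A tape: finitely supported function `ℤ → Fin 2` (blank symbol `0`). -/
abbrev Tape := ℤ →₀ Fin 2

/-- A configuration of a Turing machine with state set `Fin m`. -/
abbrev Config (m : ℕ) := Fin m × Tape

/-- A Turing machine `T = (Q, q₀, q_halt, δ)` with `Q = Fin m`, tape alphabet `Fin 2`,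
and transition function `δ : Q × Σ → Q × Σ × {-1,0,1}`. -/
structure TuringMachine (m : ℕ) where
  q0 : Fin m
  qhalt : Fin m
  hq : q0 ≠ qhalt
  δ : Fin m × Fin 2 → Fin m × Fin 2 × ℤ
  hδ : ∀ x, (δ x).2.2 = -1 ∨ (δ x).2.2 = 0 ∨ (δ x).2.2 = 1

/-- The global transition function `Δ`: the identity on halted configurations; otherwise
write `δ(q, t 0) = (q', s, ε)`, replace the symbol at position `0` by `s` and
shift the tape by `ε` (the new tape is `n ↦ t̃ (n + ε)`). -/
noncomputable def TuringMachine.step {m : ℕ} (T : TuringMachine m) (c : Config m) :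
    Config m :=
  if c.1 = T.qhalt then c
  else
    let d := T.δ (c.1, c.2 0)
    (d.1, Finsupp.equivMapDomain (Equiv.subRight d.2.2) (c.2.update 0 d.2.1))

/-- A generalized shift on the alphabet `A`, given by finite sets of positions
`D_F, D_G ⊂ ℤ` and maps `F : A^{D_F} → ℤ`, `G : A^{D_G} → A^{D_G}`. -/
structure GenShift (A : Type) where
  DF : Finset ℤ
  DG : Finset ℤ
  F : ({ i // i ∈ DF } → A) → ℤ
  G : ({ i // i ∈ DG } → A) → ({ i // i ∈ DG } → A)

/-- The map `A^ℤ → A^ℤ` defined by a generalized shift: modify `S` on the positions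
of `D_G` according to `G`, obtaining `S'`, then shift: `φ(S) n = S' (n + F(S|_{D_F}))`. -/
def GenShift.apply {A : Type} (φ : GenShift A) (S : ℤ → A) : ℤ → A :=
  fun n =>
    let n' : ℤ := n + φ.F (fun i => S i.1)
    if h : n' ∈ φ.DG then φ.G (fun i => S i.1) ⟨n', h⟩ else S n'

/-- Transport of a generalized shift along a bijection of alphabets. -/
def GenShift.congr {A B : Type} (e : A ≃ B) (φ : GenShift A) : GenShift B where
  DF := φ.DF
  DG := φ.DG
  F x := φ.F fun i => e.symm (x i)
  G x i := e (φ.G (fun j => e.symm (x j)) i)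

theorem GenShift.congr_apply {A B : Type} (e : A ≃ B) (φ : GenShift A) (S : ℤ → A) :
    (φ.congr e).apply (fun n => e (S n)) = fun n => e (φ.apply S n) := by
  funext n
  simp only [GenShift.apply, GenShift.congr, Equiv.symm_apply_apply]
  split_ifs <;> rfl

/-- The bi-infinite word of a configuration: the tape, with the state marked at the origin. -/
def Config.toWord {m : ℕ} (c : Config m) (n : ℤ) : Option (Fin m) × Fin 2 :=
  (if n = 0 then some c.1 else none, c.2 n)

theorem Config.toWord_injective {m : ℕ} :
    Function.Injective (Config.toWord : Config m → ℤ → Option (Fin m) × Fin 2) := by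
  rintro ⟨q, t⟩ ⟨q', t'⟩ h
  have hq : q = q' := by simpa [Config.toWord] using congrArg Prod.fst (congrFun h 0)
  have ht : t = t' := Finsupp.ext fun n => congrArg Prod.snd (congrFun h n)
  rw [hq, ht]

/-- The transition prescribed by a marked symbol; an unmarked symbol is read in the state `q0`. -/
def TuringMachine.transition {m : ℕ} (T : TuringMachine m) (a : Option (Fin m) × Fin 2) :
    Fin m × Fin 2 × ℤ :=
  T.δ (a.1.getD T.q0, a.2)

/-- The generalized shift simulating a Turing machine: it rewrites the symbol at the origin, moves
the state mark to the new head position and recentres the word there. -/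
def TuringMachine.genShift {m : ℕ} (T : TuringMachine m) :
    GenShift (Option (Fin m) × Fin 2) where
  DF := {0}
  DG := {-1, 0, 1}
  F x := (T.transition (x ⟨0, by simp⟩)).2.2
  G x i :=
    let d := T.transition (x ⟨0, by simp⟩)
    (if i.1 = d.2.2 then some d.1 else none, if i.1 = 0 then d.2.1 else (x i).2)

theorem TuringMachine.genShift_apply_toWord {m : ℕ} (T : TuringMachine m) (c : Config m)
    (hc : c.1 ≠ T.qhalt) : T.genShift.apply c.toWord = (T.step c).toWord := by
  have htr : T.transition (c.toWord 0) = T.δ (c.1, c.2 0) := by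
    simp [TuringMachine.transition, Config.toWord]
  funext n
  simp only [GenShift.apply, TuringMachine.genShift, htr]
  simp only [TuringMachine.step, if_neg hc, Config.toWord]
  have hε := T.hδ (c.1, c.2 0)
  generalize T.δ (c.1, c.2 0) = d at hε ⊢
  obtain ⟨q, s, ε⟩ := d
  simp only [Finsupp.equivMapDomain_apply, Equiv.subRight_symm_apply, Finsupp.update_apply,
    add_eq_right, Finset.mem_insert, Finset.mem_singleton]
  dsimp only at hε
  grind

/-- Every Turing machine is conjugate to a generalized shift: there are a finite
alphabet `A = Fin k`, a generalized shift `φ` on `A` and an injective map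
`ψ : Q × 𝒜 → A^ℤ` such that `φ(ψ c) = ψ(Δ c)` for every non-halted configuration `c`. -/
theorem statement0 (m : ℕ) (hm : 2 ≤ m) (T : TuringMachine m) :
    ∃ (k : ℕ) (φ : GenShift (Fin k)) (ψ : Config m → (ℤ → Fin k)),
      Function.Injective ψ ∧
      ∀ c : Config m, c.1 ≠ T.qhalt → φ.apply (ψ c) = ψ (T.step c) := by
  let e := Fintype.equivFin (Option (Fin m) × Fin 2)
  refine ⟨_, T.genShift.congr e, fun c n => e (c.toWord n), fun c c' h => ?_, fun c hc => ?_⟩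
  · exact Config.toWord_injective (funext fun n => e.injective (congrFun h n))
  · rw [GenShift.congr_apply, T.genShift_apply_toWord c hc]
end

section
/- For every reversible Turing machine T there exist a bijective generalized shift φ on the alphabet {0,1} and an injective map ψ : Q × 𝒜 → ({0,1})^ℤ such that φ(ψ(c)) = ψ(Δ(c)) for every configuration c whose state is not q_halt. -/
namespace TuringMachine

variable {m : ℕ} (T : TuringMachine m)

theorem step_of_ne {c : Config m} (hc : c.1 ≠ T.qhalt) :
    (T.step c).1 = (T.δ (c.1, c.2 0)).1 ∧
      ∀ n, (T.step c).2 n =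
        Function.update (⇑c.2) 0 (T.δ (c.1, c.2 0)).2.1 (n + (T.δ (c.1, c.2 0)).2.2) := by
  classical
  unfold step
  rw [if_neg hc]
  refine ⟨rfl, fun n => ?_⟩
  simp [Finsupp.equivMapDomain_apply, Function.update_apply,
    Finsupp.update_apply]

/-- Every tape carrying the written symbol at the right place is reached by a given transition. -/
theorem exists_step_eq (q : Fin m) (b : Fin 2) (hq : q ≠ T.qhalt) (U : Tape)
    (hU : U (-(T.δ (q, b)).2.2) = (T.δ (q, b)).2.1) :
    ∃ t : Tape, t 0 = b ∧ T.step (q, t) = ((T.δ (q, b)).1, U) := by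
  classical
  set ε := (T.δ (q, b)).2.2 with hε
  set t : Tape := (Finsupp.equivMapDomain (Equiv.addRight ε) U).update 0 b with ht
  have ht0 : t 0 = b := by simp [ht]
  have htn : ∀ n, n ≠ 0 → t n = U (n - ε) := by
    intro n hn
    simp [ht, Finsupp.update_apply, hn, Finsupp.equivMapDomain_apply, sub_eq_add_neg]
  obtain ⟨h1, h2⟩ := T.step_of_ne (c := (q, t)) hq
  refine ⟨t, ht0, Prod.ext ?_ (Finsupp.ext fun n => ?_)⟩
  · simpa [ht0] using h1
  · have h := h2 n
    simp only [ht0] at h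
    rw [h, ← hε]
    by_cases hn : n + ε = 0
    · rw [hn, Function.update_self, ← hU]
      congr 1
      omega
    · rw [Function.update_of_ne hn, htn _ hn]
      simp

variable {T}

theorem eq_of_compatible (hrev : Set.InjOn T.step {c : Config m | c.1 ≠ T.qhalt})
    {q₁ q₂ : Fin m} {b₁ b₂ : Fin 2} (h₁ : q₁ ≠ T.qhalt) (h₂ : q₂ ≠ T.qhalt)
    (hq : (T.δ (q₁, b₁)).1 = (T.δ (q₂, b₂)).1) (U : Tape)
    (hU₁ : U (-(T.δ (q₁, b₁)).2.2) = (T.δ (q₁, b₁)).2.1)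
    (hU₂ : U (-(T.δ (q₂, b₂)).2.2) = (T.δ (q₂, b₂)).2.1) :
    (q₁, b₁) = (q₂, b₂) := by
  obtain ⟨t₁, ht₁, hs₁⟩ := T.exists_step_eq q₁ b₁ h₁ U hU₁
  obtain ⟨t₂, ht₂, hs₂⟩ := T.exists_step_eq q₂ b₂ h₂ U hU₂
  have h : ((q₁, t₁) : Config m) = (q₂, t₂) := hrev h₁ h₂ (by rw [hs₁, hs₂, hq])
  simp only [Prod.mk.injEq] at h ⊢
  exact ⟨h.1, by rw [← ht₁, ← ht₂, h.2]⟩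

/-- In a reversible machine the direction of a move is determined by the state it leads to. -/
theorem move_eq_of_state_eq (hrev : Set.InjOn T.step {c : Config m | c.1 ≠ T.qhalt})
    {q₁ q₂ : Fin m} {b₁ b₂ : Fin 2} (h₁ : q₁ ≠ T.qhalt) (h₂ : q₂ ≠ T.qhalt)
    (hq : (T.δ (q₁, b₁)).1 = (T.δ (q₂, b₂)).1) :
    (T.δ (q₁, b₁)).2.2 = (T.δ (q₂, b₂)).2.2 := by
  classical
  by_contra hne
  have h := eq_of_compatible hrev h₁ h₂ hq
    ((Finsupp.single (-(T.δ (q₁, b₁)).2.2) (T.δ (q₁, b₁)).2.1).update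
      (-(T.δ (q₂, b₂)).2.2) (T.δ (q₂, b₂)).2.1)
    (by simp [Finsupp.update_apply, hne]) (by simp)
  exact hne (by rw [h])

/-- In a reversible machine a transition is determined by the state it leads to and the symbol
it writes. -/
theorem transition_injective (hrev : Set.InjOn T.step {c : Config m | c.1 ≠ T.qhalt})
    {q₁ q₂ : Fin m} {b₁ b₂ : Fin 2} (h₁ : q₁ ≠ T.qhalt) (h₂ : q₂ ≠ T.qhalt)
    (hq : (T.δ (q₁, b₁)).1 = (T.δ (q₂, b₂)).1)
    (hs : (T.δ (q₁, b₁)).2.1 = (T.δ (q₂, b₂)).2.1) :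
    (q₁, b₁) = (q₂, b₂) := by
  have hε := move_eq_of_state_eq hrev h₁ h₂ hq
  exact eq_of_compatible hrev h₁ h₂ hq
    (Finsupp.single (-(T.δ (q₁, b₁)).2.2) (T.δ (q₁, b₁)).2.1) (by simp) (by simp [← hε, hs])

end TuringMachine

/-- The binary sequence obtained by inserting a block of length `k` just before position `0`
of a tape. -/
def insertBlock (k : ℕ) (c : Fin k → Fin 2) (t : ℤ → Fin 2) (n : ℤ) : Fin 2 :=
  if n < 0 then t n else if h : n.toNat < k then c ⟨n.toNat, h⟩ else t (n - k)

/-- The block of length `k` of a binary sequence starting at position `0`. -/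
def blockOf (k : ℕ) (S : ℤ → Fin 2) (i : Fin k) : Fin 2 := S (i : ℕ)

/-- The binary sequence left after deleting the block of length `k` starting at position `0`. -/
def deleteBlock (k : ℕ) (S : ℤ → Fin 2) (n : ℤ) : Fin 2 := if n < 0 then S n else S (n + k)

/-- Binary sequences are pairs of a block of length `k` and a tape. -/
def insertBlockEquiv (k : ℕ) : (Fin k → Fin 2) × (ℤ → Fin 2) ≃ (ℤ → Fin 2) where
  toFun p := insertBlock k p.1 p.2
  invFun S := (blockOf k S, deleteBlock k S)
  left_inv p := by
    refine Prod.ext (funext fun i => ?_) (funext fun n => ?_)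
    · simp [blockOf, insertBlock]
    · simp only [deleteBlock, insertBlock]
      split_ifs <;> first | rfl | (exfalso; omega) | exact congrArg p.2 (by omega)
  right_inv S := by
    funext n
    simp only [deleteBlock, insertBlock, blockOf]
    split_ifs <;> first | rfl | omega | (congr 1; omega)

/-- Moving a tape by an amount that depends on the block. -/
def moveEquiv {C : Type} (e : C → ℤ) : C × (ℤ → Fin 2) ≃ C × (ℤ → Fin 2) where
  toFun p := (p.1, fun n => p.2 (n + e p.1))
  invFun p := (p.1, fun n => p.2 (n - e p.1))
  left_inv p := by simp
  right_inv p := by simp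

/-- Permuting the block together with the symbol at position `0`. -/
def rewriteEquiv {C : Type} (σ : Equiv.Perm (C × Fin 2)) :
    C × (ℤ → Fin 2) ≃ C × (ℤ → Fin 2) where
  toFun p := ((σ (p.1, p.2 0)).1, Function.update p.2 0 (σ (p.1, p.2 0)).2)
  invFun p := ((σ.symm (p.1, p.2 0)).1, Function.update p.2 0 (σ.symm (p.1, p.2 0)).2)
  left_inv p := by simp
  right_inv p := by simp

/-- The bijection of binary sequences that rewrites the block and the symbol following it by `σ`,
and then moves the tape by an amount `e` of the new block. -/
def blockMachine (k : ℕ) (σ : Equiv.Perm ((Fin k → Fin 2) × Fin 2)) (e : (Fin k → Fin 2) → ℤ) :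
    (ℤ → Fin 2) ≃ (ℤ → Fin 2) :=
  (insertBlockEquiv k).symm.trans
    ((rewriteEquiv σ).trans ((moveEquiv e).trans (insertBlockEquiv k)))

/-- The block and symbol written by `blockMachine`. -/
def blockOutput (k : ℕ) (σ : Equiv.Perm ((Fin k → Fin 2) × Fin 2)) (S : ℤ → Fin 2) :
    (Fin k → Fin 2) × Fin 2 := σ (blockOf k S, S k)

theorem blockMachine_apply (k : ℕ) (σ : Equiv.Perm ((Fin k → Fin 2) × Fin 2))
    (e : (Fin k → Fin 2) → ℤ) (S : ℤ → Fin 2) :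
    blockMachine k σ e S = insertBlock k (blockOutput k σ S).1 (fun n =>
      Function.update (deleteBlock k S) 0 (blockOutput k σ S).2
        (n + e (blockOutput k σ S).1)) := by
  simp [blockMachine, insertBlockEquiv, moveEquiv, rewriteEquiv, blockOutput, deleteBlock]

/-- Extension by `0` of a binary pattern on a finite window. -/
def extendZero (D : Finset ℤ) (w : { i // i ∈ D } → Fin 2) (n : ℤ) : Fin 2 :=
  if h : n ∈ D then w ⟨n, h⟩ else 0

theorem blockOutput_congr (k : ℕ) (σ : Equiv.Perm ((Fin k → Fin 2) × Fin 2))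
    {S S' : ℤ → Fin 2} (h : ∀ n ∈ Finset.Icc (-1 : ℤ) k, S n = S' n) :
    blockOutput k σ S = blockOutput k σ S' := by
  have h1 : blockOf k S = blockOf k S' := by
    funext i
    have := i.2
    exact h _ (by simp only [Finset.mem_Icc]; omega)
  unfold blockOutput
  rw [h1, h k (by simp only [Finset.mem_Icc]; omega)]

theorem blockMachine_congr (k : ℕ) (σ : Equiv.Perm ((Fin k → Fin 2) × Fin 2))
    (e : (Fin k → Fin 2) → ℤ) (he : ∀ c, e c = -1 ∨ e c = 0 ∨ e c = 1)
    {S S' : ℤ → Fin 2} (h : ∀ n ∈ Finset.Icc (-1 : ℤ) k, S n = S' n) (n : ℤ)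
    (hn : n + e (blockOutput k σ S).1 ∈ Finset.Icc (-1 : ℤ) k) :
    blockMachine k σ e S n = blockMachine k σ e S' n := by
  rw [blockMachine_apply, blockMachine_apply, ← blockOutput_congr k σ h]
  have he' := he (blockOutput k σ S).1
  generalize e (blockOutput k σ S).1 = ε at *
  simp only [Finset.mem_Icc] at h hn
  simp only [insertBlock, deleteBlock, Function.update_apply]
  split_ifs <;> first | rfl | omega | (apply h; omega)

theorem blockMachine_of_notMem (k : ℕ) (σ : Equiv.Perm ((Fin k → Fin 2) × Fin 2))
    (e : (Fin k → Fin 2) → ℤ) (he : ∀ c, e c = -1 ∨ e c = 0 ∨ e c = 1) (S : ℤ → Fin 2) (n : ℤ)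
    (hn : n + e (blockOutput k σ S).1 ∉ Finset.Icc (-1 : ℤ) k) :
    blockMachine k σ e S n = S (n + e (blockOutput k σ S).1) := by
  rw [blockMachine_apply]
  have he' := he (blockOutput k σ S).1
  generalize e (blockOutput k σ S).1 = ε at *
  simp only [Finset.mem_Icc] at hn
  simp only [insertBlock, deleteBlock, Function.update_apply]
  split_ifs <;> first | rfl | omega | (congr 1; omega)

/-- The generalized shift realizing `blockMachine`. -/
noncomputable def blockShift (k : ℕ) (σ : Equiv.Perm ((Fin k → Fin 2) × Fin 2)) (e : (Fin k → Fin 2) → ℤ) :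
    GenShift (Fin 2) where
  DF := Finset.Icc (-1) k
  DG := Finset.Icc (-1) k
  F w := e (blockOutput k σ (extendZero _ w)).1
  G w i := blockMachine k σ e (extendZero _ w)
    (i.1 - e (blockOutput k σ (extendZero _ w)).1)

theorem blockShift_apply (k : ℕ) (σ : Equiv.Perm ((Fin k → Fin 2) × Fin 2))
    (e : (Fin k → Fin 2) → ℤ) (he : ∀ c, e c = -1 ∨ e c = 0 ∨ e c = 1) :
    (blockShift k σ e).apply = blockMachine k σ e := by
  funext S n
  have h : ∀ n ∈ Finset.Icc (-1 : ℤ) k,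
      S n = extendZero (Finset.Icc (-1 : ℤ) k) (fun i => S i.1) n := by
    intro n hn
    rw [extendZero, dif_pos hn]
  have hF : (blockShift k σ e).F (fun i => S i.1) = e (blockOutput k σ S).1 := by
    rw [blockOutput_congr k σ h]
    rfl
  simp only [GenShift.apply, hF]
  split_ifs with hn
  · rw [blockMachine_congr k σ e he h n hn]
    simp only [blockShift, ← blockOutput_congr k σ h, add_sub_cancel_right]
  · exact (blockMachine_of_notMem k σ e he S n hn).symm

/-- The transitions of a reversible machine extend to a permutation of blocks and symbols, the
direction of the move being a function of the new block. -/
theorem TuringMachine.exists_perm_extending {m : ℕ} {T : TuringMachine m}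
    (hrev : Set.InjOn T.step {c : Config m | c.1 ≠ T.qhalt})
    {C : Type} [Finite C] (code : Fin m ↪ C) :
    ∃ (σ : Equiv.Perm (C × Fin 2)) (e : C → ℤ), (∀ c, e c = -1 ∨ e c = 0 ∨ e c = 1) ∧
      ∀ q b, q ≠ T.qhalt → σ (code q, b) = (code (T.δ (q, b)).1, (T.δ (q, b)).2.1) ∧
        e (code (T.δ (q, b)).1) = (T.δ (q, b)).2.2 := by
  classical
  have := Fintype.ofFinite C
  let i : {q // q ≠ T.qhalt} × Fin 2 → C × Fin 2 := fun p => (code p.1, p.2)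
  let j : {q // q ≠ T.qhalt} × Fin 2 → C × Fin 2 :=
    fun p => (code (T.δ (p.1, p.2)).1, (T.δ (p.1, p.2)).2.1)
  have hi : Function.Injective i := by
    rintro ⟨⟨q, hq⟩, b⟩ ⟨⟨q', hq'⟩, b'⟩ h
    simpa [i] using h
  have hj : Function.Injective j := by
    rintro ⟨⟨q, hq⟩, b⟩ ⟨⟨q', hq'⟩, b'⟩ h
    simp only [j, Prod.mk.injEq, EmbeddingLike.apply_eq_iff_eq] at h
    simpa using transition_injective hrev hq hq' h.1 h.2
  let g := (Equiv.ofInjective i hi).symm.trans (Equiv.ofInjective j hj)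
  let e : C → ℤ := fun c =>
    if h : ∃ p : {q // q ≠ T.qhalt} × Fin 2, code (T.δ (p.1, p.2)).1 = c then
      (T.δ (h.choose.1, h.choose.2)).2.2 else 0
  refine ⟨g.extendSubtype, e, fun c => ?_, fun q b hq => ⟨?_, ?_⟩⟩
  · simp only [e]
    split_ifs
    · exact T.hδ _
    · simp
  · have h := g.extendSubtype_apply_of_mem (i (⟨q, hq⟩, b)) ⟨_, rfl⟩
    rw [show (code q, b) = i (⟨q, hq⟩, b) from rfl, h]
    simp only [g, Equiv.trans_apply]
    rw [show (⟨i (⟨q, hq⟩, b), ⟨_, rfl⟩⟩ : Set.range i) =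
      Equiv.ofInjective i hi (⟨q, hq⟩, b) from rfl, Equiv.symm_apply_apply]
    rfl
  · have h : ∃ p : {q // q ≠ T.qhalt} × Fin 2,
        code (T.δ (p.1, p.2)).1 = code (T.δ (q, b)).1 := ⟨(⟨q, hq⟩, b), rfl⟩
    simp only [e]
    rw [dif_pos h]
    exact move_eq_of_state_eq hrev h.choose.1.2 hq (code.injective h.choose_spec)

/-- The encoding of a state by the block whose only `1` is at the index of the state. -/
def oneHot (m : ℕ) : Fin m ↪ (Fin m → Fin 2) where
  toFun q := Pi.single q 1
  inj' q q' h := by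
    by_contra hne
    have h' := congrFun h q
    simp [hne] at h'

/-- Every reversible Turing machine is conjugate to a bijective generalized shift on
the alphabet `{0,1}`. -/
theorem statement1 (m : ℕ) (hm : 2 ≤ m) (T : TuringMachine m)
    (hrev : Set.InjOn T.step {c : Config m | c.1 ≠ T.qhalt}) :
    ∃ (φ : GenShift (Fin 2)) (ψ : Config m → (ℤ → Fin 2)),
      Function.Bijective φ.apply ∧
      Function.Injective ψ ∧
      ∀ c : Config m, c.1 ≠ T.qhalt → φ.apply (ψ c) = ψ (T.step c) := by
  obtain ⟨σ, e, he, hσ⟩ := TuringMachine.exists_perm_extending hrev (oneHot m)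
  refine ⟨blockShift m σ e,
    fun c => insertBlockEquiv m (oneHot m c.1, c.2), ?_, ?_, ?_⟩
  · rw [blockShift_apply m σ e he]
    exact (blockMachine m σ e).bijective
  · rintro ⟨q, t⟩ ⟨q', t'⟩ h
    have h' := (insertBlockEquiv m).injective h
    simp only [Prod.mk.injEq] at h' ⊢
    exact ⟨(oneHot m).injective h'.1, DFunLike.coe_injective h'.2⟩
  · rintro ⟨q, t⟩ hq
    obtain ⟨h1, h2⟩ := T.step_of_ne hq
    obtain ⟨h3, h4⟩ := hσ q (t 0) hq
    rw [blockShift_apply m σ e he]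
    simp only [blockMachine, Equiv.trans_apply, Equiv.symm_apply_apply, rewriteEquiv, moveEquiv,
      Equiv.coe_fn_mk]
    congr 1
    refine Prod.ext ?_ (funext fun n => ?_)
    · simp only [h3, h1]
    · simp only [h3, h4, h2]
end

section
/- For every generalized shift φ on the alphabet {0,1} there exist finitely many cylinder sets C₁, …, C_N partitioning ({0,1})^ℤ (a cylinder set is determined by fixing the values of the sequence on a finite subset of ℤ), integers n₁, …, n_N, and real pairs (a₁, b₁), …, (a_N, b_N) such that for every α ∈ {1, …, N} and every s ∈ C_α one has e(φ(s)) = (3^{−n_α}·e(s)₁ + a_α, 3^{n_α}·e(s)₂ + b_α). In other words, under the Cantor encoding, φ is conjugate to a map of the square Cantor set that on each of finitely many blocks is an affine, area-preserving map (a composition of a translation and a power of the Baker's map). Moreover, if φ is bijective, the image sets e(φ(C₁)), …, e(φ(C_N)) are pairwise disjoint. -/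
/-- The Cantor encoding `e : {0,1}^ℤ → ℝ²`,
`e(s) = (Σ_{i≥1} 2 s(−i) 3^{−i}, Σ_{i≥0} 2 s(i) 3^{−i−1})`. -/
noncomputable def cantorEnc (s : ℤ → Fin 2) : ℝ × ℝ :=
  (∑' i : ℕ, 2 * ((s (-(i + 1 : ℕ) : ℤ)) : ℕ) * ((3 : ℝ)⁻¹) ^ (i + 1),
   ∑' i : ℕ, 2 * ((s (i : ℤ)) : ℕ) * ((3 : ℝ)⁻¹) ^ (i + 1))

/-- The ternary Cantor set `C = {Σ_{i≥1} a_i 3^{−i} : a_i ∈ {0,2}}`. -/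
def cantorTernarySet : Set ℝ :=
  {x | ∃ a : ℕ → ℝ, (∀ i, a i = 0 ∨ a i = 2) ∧ x = ∑' i : ℕ, a i * ((3 : ℝ)⁻¹) ^ (i + 1)}

/-- A cylinder set in `{0,1}^ℤ`: determined by fixing the values on a finite set of
positions. -/
def IsCylinder (c : Set (ℤ → Fin 2)) : Prop :=
  ∃ (D : Finset ℤ) (f : ℤ → Fin 2), c = {s | ∀ i ∈ D, s i = f i}

/-- The value in base `3` of the nonnegative half of a bi-infinite digit sequence. -/
noncomputable def ternaryValue (d : ℤ → ℝ) : ℝ :=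
  ∑' i : ℕ, d (i : ℤ) * ((3 : ℝ)⁻¹) ^ (i + 1)

/-- `ternaryValue` as a sum over all integers. -/
theorem ternaryValue_eq_tsum_int (d : ℤ → ℝ) :
    ternaryValue d = ∑' j : ℤ, if 0 ≤ j then d j * (3 : ℝ) ^ (-(j + 1)) else 0 := by
  have h : Function.Injective (fun i : ℕ => (i : ℤ)) := Nat.cast_injective
  rw [ternaryValue, ← h.tsum_eq]
  · refine tsum_congr fun i => ?_
    rw [if_pos (Int.natCast_nonneg i), zpow_neg, inv_pow]
    norm_cast
  · intro j hj
    have h0 : 0 ≤ j := by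
      by_contra hn
      exact hj (if_neg hn)
    exact ⟨j.toNat, Int.toNat_of_nonneg h0⟩

/-- Shifting a digit sequence that vanishes near the origin scales its value. -/
theorem ternaryValue_shift (d : ℤ → ℝ) (k : ℤ) (hd : ∀ j, |j| ≤ |k| → d j = 0) :
    ternaryValue (fun i => d (i + k)) = (3 : ℝ) ^ k * ternaryValue d := by
  rw [ternaryValue_eq_tsum_int, ternaryValue_eq_tsum_int, ← tsum_mul_left,
    ← (Equiv.subRight k).tsum_eq]
  refine tsum_congr fun j => ?_
  by_cases hj : |j| ≤ |k|
  · simp [hd j hj]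
  · have hiff : 0 ≤ j - k ↔ 0 ≤ j := by
      rcases abs_cases j with h | h <;> rcases abs_cases k with h' | h' <;> omega
    simp only [Equiv.subRight_apply, sub_add_cancel, hiff]
    split_ifs
    · rw [show -(j - k + 1) = k + -(j + 1) by ring, zpow_add₀ (by norm_num)]
      ring
    · simp

theorem summable_ternary (s : ℤ → Fin 2) :
    Summable fun i : ℕ => 2 * ((s i : ℕ) : ℝ) * ((3 : ℝ)⁻¹) ^ (i + 1) := by
  have hg : Summable fun i : ℕ => 2 * ((3 : ℝ)⁻¹) ^ (i + 1) :=
    ((summable_nat_add_iff 1).2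
      (summable_geometric_of_lt_one (by norm_num) (by norm_num))).mul_left 2
  refine hg.of_nonneg_of_le (fun i => by positivity) fun i => ?_
  have h : ((s i : ℕ) : ℝ) ≤ 1 := by exact_mod_cast Nat.le_of_lt_succ (s i).isLt
  have hp : (0 : ℝ) ≤ ((3 : ℝ)⁻¹) ^ (i + 1) := by positivity
  nlinarith

theorem ternaryValue_sub (s t : ℤ → Fin 2) :
    ternaryValue (fun i => 2 * ((s i : ℕ) : ℝ)) - ternaryValue (fun i => 2 * ((t i : ℕ) : ℝ)) =
      ternaryValue (fun i => 2 * ((s i : ℕ) : ℝ) - 2 * ((t i : ℕ) : ℝ)) := by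
  rw [ternaryValue, ternaryValue, ← (summable_ternary s).tsum_sub (summable_ternary t)]
  exact tsum_congr fun i => by ring

/-- If `s` and `t` agree near the origin and the differences of `s'` and `t'` are those of `s`
and `t` shifted by `k`, then the values differ by the factor `3 ^ k`. -/
theorem ternaryValue_sub_shift (s t s' t' : ℤ → Fin 2) (k : ℤ)
    (hst : ∀ j, |j| ≤ |k| → s j = t j)
    (h : ∀ n, s' n = s (n + k) ∧ t' n = t (n + k) ∨ s' n = t' n ∧ s (n + k) = t (n + k)) :
    ternaryValue (fun i => 2 * ((s' i : ℕ) : ℝ)) - ternaryValue (fun i => 2 * ((t' i : ℕ) : ℝ)) =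
      (3 : ℝ) ^ k * (ternaryValue (fun i => 2 * ((s i : ℕ) : ℝ)) -
        ternaryValue (fun i => 2 * ((t i : ℕ) : ℝ))) := by
  rw [ternaryValue_sub, ternaryValue_sub, ← ternaryValue_shift _ k]
  · congr 1
    funext n
    rcases h n with ⟨h1, h2⟩ | ⟨h1, h2⟩
    · rw [h1, h2]
    · rw [h1, h2, sub_self, sub_self]
  · intro j hj
    rw [hst j hj, sub_self]

theorem cantorEnc_eq (s : ℤ → Fin 2) :
    cantorEnc s = (ternaryValue (fun i => 2 * ((s (-(i + 1)) : ℕ) : ℝ)),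
      ternaryValue (fun i => 2 * ((s i : ℕ) : ℝ))) := by
  simp [cantorEnc, ternaryValue]

theorem eq_of_ternaryValue_eq (s t : ℤ → Fin 2)
    (h : ternaryValue (fun i => 2 * ((s i : ℕ) : ℝ)) =
      ternaryValue (fun i => 2 * ((t i : ℕ) : ℝ))) (i : ℕ) : s i = t i := by
  have key : ∀ u : ℤ → Fin 2, ternaryValue (fun i => 2 * ((u i : ℕ) : ℝ)) =
      (2 / 3) * Cardinal.cantorFunction (1 / 3) (fun i : ℕ => decide (u i = 1)) := by
    intro u
    rw [ternaryValue, Cardinal.cantorFunction, ← tsum_mul_left]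
    refine tsum_congr fun i => ?_
    rcases Fin.exists_fin_two.1 ⟨u i, rfl⟩ with hu | hu
    · simp [Cardinal.cantorFunctionAux, hu]
    · simp [Cardinal.cantorFunctionAux, hu, pow_succ]
      ring
  rw [key, key] at h
  have hc := Cardinal.cantorFunction_injective (c := 1 / 3) (by norm_num) (by norm_num)
    (mul_left_cancel₀ (by norm_num) h)
  have hi := congrFun hc i
  simp only [decide_eq_decide] at hi
  omega

theorem cantorEnc_injective : Function.Injective cantorEnc := by
  intro s t h
  rw [cantorEnc_eq, cantorEnc_eq, Prod.mk.injEq] at h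
  funext j
  rcases le_or_gt 0 j with hj | hj
  · have := eq_of_ternaryValue_eq s t h.2 j.toNat
    rwa [Int.toNat_of_nonneg hj] at this
  · have := eq_of_ternaryValue_eq (fun i => s (-(i + 1))) (fun i => t (-(i + 1))) h.1
      (-(j + 1)).toNat
    rw [Int.toNat_of_nonneg (by omega)] at this
    simpa using this

/-- On sequences agreeing on a large enough finite window, a generalized shift is affine with
linear part a power of the Baker's map. -/
theorem cantorEnc_apply_sub (φ : GenShift (Fin 2)) (s t : ℤ → Fin 2)
    (hF : ∀ i ∈ φ.DF, s i = t i) (hG : ∀ i ∈ φ.DG, s i = t i)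
    (hk : ∀ j : ℤ, |j| ≤ |φ.F (fun i => t i.1)| + 1 → s j = t j) :
    cantorEnc (φ.apply s) - cantorEnc (φ.apply t) =
      ((3 : ℝ) ^ (-φ.F (fun i => t i.1)) * ((cantorEnc s).1 - (cantorEnc t).1),
        (3 : ℝ) ^ (φ.F (fun i => t i.1)) * ((cantorEnc s).2 - (cantorEnc t).2)) := by
  have hFs : φ.F (fun i => s i.1) = φ.F (fun i => t i.1) :=
    congrArg φ.F (funext fun i => hF i.1 i.2)
  have hGs : φ.G (fun i => s i.1) = φ.G (fun i => t i.1) :=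
    congrArg φ.G (funext fun i => hG i.1 i.2)
  have happ : ∀ n, φ.apply s n = s (n + φ.F (fun i => t i.1)) ∧
      φ.apply t n = t (n + φ.F (fun i => t i.1)) ∨
      φ.apply s n = φ.apply t n ∧
        s (n + φ.F (fun i => t i.1)) = t (n + φ.F (fun i => t i.1)) := by
    intro n
    simp only [GenShift.apply, hFs, hGs]
    by_cases hn : n + φ.F (fun i => t i.1) ∈ φ.DG
    · right
      simp [hn, hG _ hn]
    · left
      simp [hn]
  generalize φ.F (fun i => t i.1) = k at *
  simp only [cantorEnc_eq, Prod.mk_sub_mk]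
  refine Prod.ext ?_ ?_
  · refine ternaryValue_sub_shift (fun i => s (-(i + 1))) (fun i => t (-(i + 1)))
      (fun i => φ.apply s (-(i + 1))) (fun i => φ.apply t (-(i + 1))) (-k) ?_ ?_
    · intro j hj
      rw [abs_neg] at hj
      refine hk _ ?_
      rw [abs_neg]
      exact (abs_add_le j 1).trans (by simpa using hj)
    · intro n
      have := happ (-(n + 1))
      rwa [show -(n + 1) + k = -(n + -k + 1) by ring] at this
  · exact ternaryValue_sub_shift s t _ _ k (fun j hj => hk j (by omega)) happ

/-- Under the Cantor encoding, any generalized shift on `{0,1}` is conjugate to a map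
of the square Cantor set which is affine (a translation composed with a power of the
Baker's map) on each of finitely many blocks; the blocks come from a partition of
`{0,1}^ℤ` into cylinder sets. If `φ` is bijective, the image blocks are pairwise
disjoint. -/
theorem statement3 (φ : GenShift (Fin 2)) :
    ∃ (N : ℕ) (Cyl : Fin N → Set (ℤ → Fin 2)) (n : Fin N → ℤ) (a b : Fin N → ℝ),
      (∀ α, IsCylinder (Cyl α)) ∧
      Pairwise (Function.onFun Disjoint Cyl) ∧
      (⋃ α, Cyl α) = Set.univ ∧
      (∀ α, ∀ s ∈ Cyl α,
        cantorEnc (φ.apply s) =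
          ((3 : ℝ) ^ (-(n α)) * (cantorEnc s).1 + a α,
           (3 : ℝ) ^ (n α) * (cantorEnc s).2 + b α)) ∧
      (Function.Bijective φ.apply →
        Pairwise (Function.onFun Disjoint
          (fun α => cantorEnc '' (φ.apply '' Cyl α)))) := by
  obtain ⟨M, hM⟩ := (Set.finite_range fun x => |φ.F x| + 1).bddAbove
  let D : Finset ℤ := φ.DF ∪ φ.DG ∪ Finset.Icc (-M) M
  let e : Fin (Fintype.card (D → Fin 2)) ≃ (D → Fin 2) := (Fintype.equivFin _).symm
  let r : Fin (Fintype.card (D → Fin 2)) → ℤ → Fin 2 :=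
    fun α i => if h : i ∈ D then e α ⟨i, h⟩ else 0
  have hr : ∀ α i (h : i ∈ D), r α i = e α ⟨i, h⟩ := fun α i h => dif_pos h
  let Cyl : Fin (Fintype.card (D → Fin 2)) → Set (ℤ → Fin 2) :=
    fun α => {s | ∀ i ∈ D, s i = r α i}
  have hdisj : Pairwise (Function.onFun Disjoint Cyl) := by
    intro α β hαβ
    refine Set.disjoint_left.2 fun s hα hβ => hαβ (e.injective (funext fun i => ?_))
    rw [← hr α i.1 i.2, ← hr β i.1 i.2, ← hα i.1 i.2, ← hβ i.1 i.2]
  refine ⟨_, Cyl, fun α => φ.F (fun i => r α i.1),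
    fun α => (cantorEnc (φ.apply (r α))).1 -
      (3 : ℝ) ^ (-φ.F (fun i => r α i.1)) * (cantorEnc (r α)).1,
    fun α => (cantorEnc (φ.apply (r α))).2 -
      (3 : ℝ) ^ (φ.F (fun i => r α i.1)) * (cantorEnc (r α)).2,
    fun α => ⟨D, r α, rfl⟩, hdisj, ?_, ?_, ?_⟩
  · refine Set.eq_univ_of_forall fun s => Set.mem_iUnion.2 ⟨e.symm fun i => s i.1, ?_⟩
    intro i hi
    rw [hr _ i hi, Equiv.apply_symm_apply]
  · intro α s hs
    have h := cantorEnc_apply_sub φ s (r α) (fun i hi => hs i (by simp [D, hi]))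
      (fun i hi => hs i (by simp [D, hi])) fun j hj => hs j <| by
        have hjM := abs_le.1 (hj.trans (hM ⟨_, rfl⟩))
        simp [D, hjM.1, hjM.2]
    rw [Prod.ext_iff] at h
    obtain ⟨h1, h2⟩ := h
    simp only [Prod.fst_sub, Prod.snd_sub] at h1 h2
    exact Prod.ext (by linear_combination h1) (by linear_combination h2)
  · intro hφ α β hαβ
    exact (Set.disjoint_image_iff cantorEnc_injective).2
      ((Set.disjoint_image_iff hφ.injective).2 (hdisj hαβ))
end

section
/- For every bijective generalized shift φ on the alphabet {0,1} there exist a C^∞ diffeomorphism Φ : ℝ² → ℝ² that preserves Lebesgue measure and satisfies Φ(x) = x for every x outside the open unit disk B(0,1), together with a point c ∈ ℝ² and a scale ρ > 0 such that the affine map ι(z) = c + ρ·z sends [0,1]² into B(0,1) and Φ(ι(e(s))) = ι(e(φ(s))) for all s ∈ ({0,1})^ℤ. That is, every bijective generalized shift extends to a smooth area-preserving diffeomorphism of the disk that is the identity near the boundary and whose restriction to the square Cantor set is conjugate to φ. -/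
/-- The open unit disk in `ℝ²`. -/
def unitDisk : Set (ℝ × ℝ) := {p | p.1 ^ 2 + p.2 ^ 2 < 1}

open MeasureTheory Set Filter Topology
open scoped ContDiff

/-- The group of smooth area-preserving diffeomorphisms of the plane with bounded support. -/
def boundedAreaDiffeo : Subgroup (Equiv.Perm (ℝ × ℝ)) where
  carrier := {Φ | ContDiff ℝ ∞ Φ ∧ ContDiff ℝ ∞ Φ.symm ∧ MeasurePreserving Φ volume volume ∧
    ∃ R : ℝ, ∀ x, R ≤ ‖x‖ → Φ x = x}
  one_mem' := ⟨contDiff_id, contDiff_id, MeasurePreserving.id _, 0, fun _ _ => rfl⟩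
  mul_mem' := by
    rintro Φ Ψ ⟨h1, h2, h3, R, h4⟩ ⟨k1, k2, k3, S, k4⟩
    refine ⟨h1.comp k1, k2.comp h2, h3.comp k3, max R S, fun x hx => ?_⟩
    rw [Equiv.Perm.mul_apply, k4 x ((le_max_right _ _).trans hx),
      h4 x ((le_max_left _ _).trans hx)]
  inv_mem' := by
    rintro Φ ⟨h1, h2, h3, R, h4⟩
    refine ⟨h2, h1, ?_, R, fun x hx => ?_⟩
    · exact MeasurePreserving.symm (⟨Φ, h1.continuous.measurable, h2.continuous.measurable⟩ :
        (ℝ × ℝ) ≃ᵐ (ℝ × ℝ)) h3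
    · exact (Equiv.symm_apply_eq Φ).2 (h4 x hx).symm

/-- The determinant of a linear endomorphism of the plane. -/
lemma det_plane (T : (ℝ × ℝ) →L[ℝ] (ℝ × ℝ)) :
    T.det = (T (1, 0)).1 * (T (0, 1)).2 - (T (0, 1)).1 * (T (1, 0)).2 := by
  rw [ContinuousLinearMap.det, ← LinearMap.det_toMatrix (Module.Basis.finTwoProd ℝ),
    Matrix.det_fin_two]
  simp [LinearMap.toMatrix_apply]

/-- Perturbing the identity of the line by a small bounded function keeps it bijective. -/
lemma bijective_add_of_deriv_le {w : ℝ → ℝ} (hw : Differentiable ℝ w)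
    (hd : ∀ y, |deriv w y| ≤ 1 / 2) {C : ℝ} (hC : ∀ y, |w y| ≤ C) :
    Function.Bijective (fun y => y + w y) := by
  constructor
  · refine (strictMono_of_deriv_pos fun y => ?_).injective
    have h : HasDerivAt (fun y => y + w y) (1 + deriv w y) y :=
      (hasDerivAt_id y).add (hw y).hasDerivAt
    rw [h.deriv]
    have := (abs_le.1 (hd y)).1
    linarith
  · refine Continuous.surjective (continuous_id.add hw.continuous) ?_ ?_
    · exact tendsto_atTop_add_right_of_le _ (-C) tendsto_id fun y => (abs_le.1 (hC y)).1
    · exact tendsto_atBot_add_right_of_ge _ C tendsto_id fun y => (abs_le.1 (hC y)).2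

/-- A smooth bijection of the plane with invertible derivative has a smooth inverse. -/
lemma contDiff_symm_of_det_ne_zero (A : (ℝ × ℝ) ≃ (ℝ × ℝ)) (hA : ContDiff ℝ ∞ A)
    (hdet : ∀ p, (fderiv ℝ A p).det ≠ 0) : ContDiff ℝ ∞ A.symm := by
  have hs : ∀ p, HasStrictFDerivAt A ((ContinuousLinearMap.toContinuousLinearEquivOfDetNeZero
      (fderiv ℝ A p) (hdet p) : (ℝ × ℝ) ≃L[ℝ] (ℝ × ℝ)) : (ℝ × ℝ) →L[ℝ] (ℝ × ℝ)) p := by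
    intro p
    simpa using hA.contDiffAt.hasStrictFDerivAt (by simp)
  have ho : IsOpenMap A :=
    isOpenMap_iff_nhds_le.2 fun p => ((hs p).map_nhds_eq_of_equiv).ge
  exact Homeomorph.contDiff_symm (A.toHomeomorphOfContinuousOpen hA.continuous ho)
    (fun p => (hs p).hasFDerivAt) hA

/-- Two diffeomorphisms with the same positive Jacobian determinant differ by an
area-preserving one. -/
lemma measurePreserving_symm_trans (A B : (ℝ × ℝ) ≃ (ℝ × ℝ)) (hA : ContDiff ℝ ∞ A)
    (hB : ContDiff ℝ ∞ B) (hA' : Continuous A.symm)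
    (hdet : ∀ p, (fderiv ℝ A p).det = (fderiv ℝ B p).det) :
    MeasurePreserving (A.symm.trans B) volume volume := by
  refine ⟨(hB.continuous.comp hA').measurable, ?_⟩
  ext s hs
  have hm : Measurable (A.symm.trans B) := (hB.continuous.comp hA').measurable
  rw [Measure.map_apply hm hs]
  have key : ∀ t : Set (ℝ × ℝ), MeasurableSet t → volume (A '' t) = volume (B '' t) := by
    intro t ht
    rw [← lintegral_abs_det_fderiv_eq_addHaar_image volume ht
        (fun x _ => ((hA.differentiable (by simp)) x).hasFDerivAt.hasFDerivWithinAt)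
        A.injective.injOn,
      ← lintegral_abs_det_fderiv_eq_addHaar_image volume ht
        (fun x _ => ((hB.differentiable (by simp)) x).hasFDerivAt.hasFDerivWithinAt)
        B.injective.injOn]
    simp only [hdet]
  have h := key (B ⁻¹' s) (hB.continuous.measurable hs)
  rw [B.image_preimage] at h
  rw [← h, A.image_eq_preimage_symm]
  rfl

/-- The map with generating function `h(x) χ(y)`: it takes `(x, y + h'(x) χ(y))` to
`(x + h(x) χ'(y), y)`. -/
lemma exists_of_generatingFunction {h χ : ℝ → ℝ} (hh : ContDiff ℝ ∞ h) (hχ : ContDiff ℝ ∞ χ)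
    (hhs : HasCompactSupport h) (hχs : HasCompactSupport χ)
    (hb : ∀ x y, |deriv h x * deriv χ y| ≤ 1 / 2) :
    ∃ Φ ∈ boundedAreaDiffeo, ∀ x y,
      Φ (x, y + deriv h x * χ y) = (x + h x * deriv χ y, y) := by
  have hh' : ContDiff ℝ ∞ (deriv h) := (contDiff_infty_iff_deriv.1 hh).2
  have hχ' : ContDiff ℝ ∞ (deriv χ) := (contDiff_infty_iff_deriv.1 hχ).2
  have dh := hh.differentiable (by simp)
  have dχ := hχ.differentiable (by simp)
  have dh' := hh'.differentiable (by simp)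
  have dχ' := hχ'.differentiable (by simp)
  obtain ⟨C₁, hC₁⟩ := hhs.exists_bound_of_continuous hh.continuous
  obtain ⟨C₂, hC₂⟩ := hχs.exists_bound_of_continuous hχ.continuous
  have bijA : ∀ x, Function.Bijective fun y => y + deriv h x * χ y := by
    intro x
    refine bijective_add_of_deriv_le (dχ.const_mul _) (fun y => ?_) (C := |deriv h x| * C₂) ?_
    · rw [deriv_const_mul _ (dχ y)]
      exact hb x y
    · intro y
      rw [abs_mul]
      exact mul_le_mul_of_nonneg_left (hC₂ y) (abs_nonneg _)
  have bijB : ∀ y, Function.Bijective fun x => x + h x * deriv χ y := by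
    intro y
    refine bijective_add_of_deriv_le (dh.mul_const _) (fun x => ?_) (C := C₁ * |deriv χ y|) ?_
    · rw [deriv_mul_const (dh x)]
      exact hb x y
    · intro x
      rw [abs_mul]
      exact mul_le_mul_of_nonneg_right (hC₁ x) (abs_nonneg _)
  let A : (ℝ × ℝ) ≃ (ℝ × ℝ) := Equiv.ofBijective (fun p => (p.1, p.2 + deriv h p.1 * χ p.2)) <| by
    constructor
    · rintro ⟨x, y⟩ ⟨x', y'⟩ hp
      simp only [Prod.mk.injEq] at hp
      obtain ⟨rfl, hp⟩ := hp
      rw [(bijA x).1 hp]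
    · rintro ⟨x, y⟩
      obtain ⟨y', hy⟩ := (bijA x).2 y
      exact ⟨(x, y'), Prod.ext rfl hy⟩
  let B : (ℝ × ℝ) ≃ (ℝ × ℝ) := Equiv.ofBijective (fun p => (p.1 + h p.1 * deriv χ p.2, p.2)) <| by
    constructor
    · rintro ⟨x, y⟩ ⟨x', y'⟩ hp
      simp only [Prod.mk.injEq] at hp
      obtain ⟨hp, rfl⟩ := hp
      rw [(bijB y).1 hp]
    · rintro ⟨x, y⟩
      obtain ⟨x', hx⟩ := (bijB y).2 x
      exact ⟨(x', y), Prod.ext hx rfl⟩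
  have cA : ContDiff ℝ ∞ A :=
    contDiff_fst.prodMk (contDiff_snd.add ((hh'.comp contDiff_fst).mul (hχ.comp contDiff_snd)))
  have cB : ContDiff ℝ ∞ B :=
    (contDiff_fst.add ((hh.comp contDiff_fst).mul (hχ'.comp contDiff_snd))).prodMk contDiff_snd
  have detA : ∀ p, (fderiv ℝ A p).det = 1 + deriv h p.1 * deriv χ p.2 := by
    intro p
    have h1 : HasFDerivAt (fun p : ℝ × ℝ => deriv h p.1) _ p :=
      (dh' p.1).hasDerivAt.comp_hasFDerivAt p (hasFDerivAt_fst (𝕜 := ℝ) (p := p))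
    have h2 : HasFDerivAt (fun p : ℝ × ℝ => χ p.2) _ p :=
      (dχ p.2).hasDerivAt.comp_hasFDerivAt p (hasFDerivAt_snd (𝕜 := ℝ) (p := p))
    have h3 : HasFDerivAt A _ p := hasFDerivAt_fst.prodMk (hasFDerivAt_snd.add (h1.mul h2))
    rw [h3.fderiv, det_plane]
    simp
  have detB : ∀ p, (fderiv ℝ B p).det = 1 + deriv h p.1 * deriv χ p.2 := by
    intro p
    have h1 : HasFDerivAt (fun p : ℝ × ℝ => h p.1) _ p :=
      (dh p.1).hasDerivAt.comp_hasFDerivAt p (hasFDerivAt_fst (𝕜 := ℝ) (p := p))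
    have h2 : HasFDerivAt (fun p : ℝ × ℝ => deriv χ p.2) _ p :=
      (dχ' p.2).hasDerivAt.comp_hasFDerivAt p (hasFDerivAt_snd (𝕜 := ℝ) (p := p))
    have h3 : HasFDerivAt B _ p := (hasFDerivAt_fst.add (h1.mul h2)).prodMk hasFDerivAt_snd
    rw [h3.fderiv, det_plane]
    simp [mul_comm]
  have hpos : ∀ p : ℝ × ℝ, 1 + deriv h p.1 * deriv χ p.2 ≠ 0 := by
    intro p
    have := (abs_le.1 (hb p.1 p.2)).1
    linarith
  have cA' := contDiff_symm_of_det_ne_zero A cA fun p => by rw [detA]; exact hpos p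
  have cB' := contDiff_symm_of_det_ne_zero B cB fun p => by rw [detB]; exact hpos p
  refine ⟨A.symm.trans B, ⟨cB.comp cA', cA.comp cB', ?_, ?_⟩, fun x y => ?_⟩
  · exact measurePreserving_symm_trans A B cA cB cA'.continuous
      fun p => by rw [detA, detB]
  · obtain ⟨R₁, hR₁⟩ := hhs.isCompact.isBounded.subset_closedBall 0
    obtain ⟨R₂, hR₂⟩ := hχs.isCompact.isBounded.subset_closedBall 0
    refine ⟨max R₁ R₂ + 1, fun p hp => ?_⟩
    have hcase : p.1 ∉ tsupport h ∨ p.2 ∉ tsupport χ := by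
      by_contra! hc
      have h1 := mem_closedBall_zero_iff.1 (hR₁ hc.1)
      have h2 := mem_closedBall_zero_iff.1 (hR₂ hc.2)
      have : ‖p‖ ≤ max R₁ R₂ := by
        rw [Prod.norm_def]
        exact max_le_max h1 h2
      linarith
    have hz : deriv h p.1 * χ p.2 = 0 ∧ h p.1 * deriv χ p.2 = 0 := by
      rcases hcase with hc | hc
      · rw [image_eq_zero_of_notMem_tsupport hc,
          image_eq_zero_of_notMem_tsupport fun hm => hc (tsupport_deriv_subset hm)]
        simp
      · rw [image_eq_zero_of_notMem_tsupport hc,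
          image_eq_zero_of_notMem_tsupport fun hm => hc (tsupport_deriv_subset hm)]
        simp
    have hAp : A p = p := Prod.ext rfl (show p.2 + deriv h p.1 * χ p.2 = p.2 by rw [hz.1, add_zero])
    have hBp : B p = p := Prod.ext (show p.1 + h p.1 * deriv χ p.2 = p.1 by rw [hz.2, add_zero]) rfl
    rw [Equiv.trans_apply, (Equiv.symm_apply_eq A).2 hAp.symm, hBp]
  · have : A.symm (x, y + deriv h x * χ y) = (x, y) := (Equiv.symm_apply_eq A).2 rfl
    rw [Equiv.trans_apply, this]
    rfl

/-- On a bounded set, a smooth vertical shear agrees with a boundedly supported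
area-preserving diffeomorphism. -/
lemma exists_eq_vertical_shear {f : ℝ → ℝ} (hf : ContDiff ℝ ∞ f) (R : ℝ) :
    ∃ Φ ∈ boundedAreaDiffeo, ∀ p : ℝ × ℝ, ‖p‖ ≤ R → Φ p = (p.1, p.2 + f p.1) := by
  wlog hR : 0 < R generalizing R
  · obtain ⟨Φ, hΦ, h⟩ := this 1 one_pos
    exact ⟨Φ, hΦ, fun p hp => h p (by linarith)⟩
  let F : ℝ → ℝ := fun x => ∫ t in (0 : ℝ)..x, f t
  have hF : ∀ x, HasDerivAt F (f x) x := fun x =>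
    intervalIntegral.integral_hasDerivAt_right (hf.continuous.intervalIntegrable _ _)
      (hf.continuous.stronglyMeasurableAtFilter _ _) hf.continuous.continuousAt
  have hF' : deriv F = f := funext fun x => (hF x).deriv
  have cF : ContDiff ℝ ∞ F :=
    contDiff_infty_iff_deriv.2 ⟨fun x => (hF x).differentiableAt, hF'.symm ▸ hf⟩
  let ψ : ContDiffBump (0 : ℝ) := ⟨R + 1, R + 2, by linarith, by linarith⟩
  let h : ℝ → ℝ := fun x => ψ x * F x
  have ch : ContDiff ℝ ∞ h := ψ.contDiff.mul cF
  have sh : HasCompactSupport h := ψ.hasCompactSupport.mul_right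
  have hh : ∀ x, |x| ≤ R → deriv h x = f x := by
    intro x hx
    have : h =ᶠ[𝓝 x] F := by
      filter_upwards [ψ.eventuallyEq_one_of_mem_ball (x := x)
        (by simp [ψ]; linarith)] with y hy
      simp only [h, hy, Pi.one_apply, one_mul]
    rw [this.deriv_eq, hF']
  let θ : ContDiffBump (0 : ℝ) := ⟨1, 2, by norm_num, by norm_num⟩
  have cθ : ContDiff ℝ ∞ θ := θ.contDiff
  obtain ⟨C₁, hC₁⟩ := sh.deriv.exists_bound_of_continuous (ch.continuous_deriv (by simp))
  obtain ⟨C₂, hC₂⟩ := θ.hasCompactSupport.deriv.exists_bound_of_continuous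
    (cθ.continuous_deriv (by simp))
  have p1 : 0 ≤ C₁ := (norm_nonneg _).trans (hC₁ 0)
  have p2 : 0 ≤ C₂ := (norm_nonneg _).trans (hC₂ 0)
  obtain ⟨δ, hδ, hδR, hδC⟩ : ∃ δ : ℝ, 0 < δ ∧ δ * R < 1 ∧ C₁ * (δ * C₂) ≤ 1 / 2 := by
    have hp : 0 < R + 2 * C₁ * C₂ + 1 := by positivity
    refine ⟨1 / (R + 2 * C₁ * C₂ + 1), by positivity, ?_, ?_⟩
    · rw [div_mul_eq_mul_div, div_lt_one hp]
      nlinarith [mul_nonneg p1 p2]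
    · rw [div_mul_eq_mul_div, mul_div_assoc', div_le_div_iff₀ hp two_pos]
      nlinarith [mul_nonneg p1 p2]
  let χ : ℝ → ℝ := fun y => θ (δ * y)
  have cχ : ContDiff ℝ ∞ χ := cθ.comp (contDiff_const.mul contDiff_id)
  have sχ : HasCompactSupport χ :=
    θ.hasCompactSupport.comp_homeomorph (Homeomorph.mulLeft₀ δ hδ.ne')
  have dχ : ∀ y, deriv χ y = δ * deriv θ (δ * y) := by
    intro y
    have := ((cθ.differentiable (by simp)) (δ * y)).hasDerivAt.comp y
      ((hasDerivAt_id y).const_mul δ)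
    rw [show χ = θ ∘ fun y => δ * y from rfl]
    rw [this.deriv]
    ring
  obtain ⟨Φ, hΦ, hΦe⟩ := exists_of_generatingFunction ch cχ sh sχ fun x y => by
    rw [abs_mul, dχ, abs_mul, abs_of_pos hδ]
    refine le_trans ?_ hδC
    gcongr
    · exact hC₁ x
    · exact hC₂ _
  refine ⟨Φ⁻¹, inv_mem hΦ, ?_⟩
  rintro ⟨x, y⟩ hp
  have hx : |x| ≤ R := (le_max_left _ _).trans hp
  have hy : |y| ≤ R := (le_max_right _ _).trans hp
  have hy1 : |δ * y| < 1 := by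
    rw [abs_mul, abs_of_pos hδ]
    exact (mul_le_mul_of_nonneg_left hy hδ.le).trans_lt hδR
  have e1 : χ y = 1 := θ.one_of_mem_closedBall (by simpa [θ] using hy1.le)
  have e2 : deriv χ y = 0 := by
    rw [dχ, (θ.eventuallyEq_one_of_mem_ball (x := δ * y) (by simpa [θ] using hy1)).deriv_eq]
    simp
  have := hΦe x y
  rw [e1, e2, hh x hx, mul_one, mul_zero, add_zero] at this
  exact (Equiv.Perm.inv_eq_iff_eq).2 this.symm

/-- A smooth function agreeing with prescribed ones at prescribed points, when the points where
the prescriptions differ are uniformly separated. -/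
lemma exists_contDiff_eq_of_separated {P : Type*} (x : P → ℝ) (f : P → ℝ → ℝ)
    (hf : ∀ s, ContDiff ℝ ∞ (f s)) {δ : ℝ} (hδ : 0 < δ)
    (hsep : ∀ s t, f s = f t ∨ δ ≤ |x s - x t|) :
    ∃ g : ℝ → ℝ, ContDiff ℝ ∞ g ∧ ∀ s, g (x s) = f s (x s) := by
  have hconv : ∀ y, Convex ℝ {v : ℝ | ∀ s, x s = y → v = f s y} := by
    intro y v hv w hw a b _ _ hab s hs
    rw [hv s hs, hw s hs, ← add_smul, hab, one_smul]
  suffices hloc : ∀ y, ∃ U ∈ 𝓝 y, ∃ g : ℝ → ℝ,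
      ContMDiffOn (modelWithCornersSelf ℝ ℝ) (modelWithCornersSelf ℝ ℝ) ∞ g U ∧
        ∀ z ∈ U, g z ∈ {v : ℝ | ∀ s, x s = z → v = f s z} by
    obtain ⟨g, hg⟩ := exists_contMDiffMap_forall_mem_convex_of_local _ (n := ⊤) hconv hloc
    exact ⟨g, g.contMDiff.contDiff, fun s => hg (x s) s rfl⟩
  intro y
  refine ⟨Metric.ball y (δ / 2), Metric.ball_mem_nhds _ (by positivity), ?_⟩
  by_cases hex : ∃ s, x s ∈ Metric.ball y (δ / 2)
  · obtain ⟨s, hs⟩ := hex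
    refine ⟨f s, (hf s).contMDiff.contMDiffOn, ?_⟩
    rintro _ hz t rfl
    rcases hsep s t with h | h
    · rw [h]
    · rw [Metric.mem_ball, Real.dist_eq] at hs hz
      rw [abs_sub_comm] at hz
      have := abs_sub_le (x s) y (x t)
      linarith
  · refine ⟨fun _ => 0, contMDiffOn_const, ?_⟩
    rintro _ hz t rfl
    exact (hex ⟨t, hz⟩).elim

/-- Two families of points of the plane are linked when some boundedly supported area-preserving
diffeomorphism takes the first to the second. -/
def Linked {P : Type*} (p q : P → ℝ × ℝ) : Prop :=
  ∃ Φ ∈ boundedAreaDiffeo, ∀ s, Φ (p s) = q s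

namespace Linked

variable {P : Type*} {p q r : P → ℝ × ℝ}

lemma symm (h : Linked p q) : Linked q p := by
  obtain ⟨Φ, hΦ, h⟩ := h
  exact ⟨Φ⁻¹, inv_mem hΦ, fun s => Equiv.Perm.inv_eq_iff_eq.2 (h s).symm⟩

lemma trans (h : Linked p q) (k : Linked q r) : Linked p r := by
  obtain ⟨Φ, hΦ, h⟩ := h
  obtain ⟨Ψ, hΨ, k⟩ := k
  exact ⟨Ψ * Φ, mul_mem hΨ hΦ, fun s => by rw [Equiv.Perm.mul_apply, h, k]⟩

lemma swap (h : Linked p q) : Linked (fun s => (p s).swap) (fun s => (q s).swap) := by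
  obtain ⟨Φ, ⟨h1, h2, h3, R, h4⟩, h⟩ := h
  have hs : ContDiff ℝ ∞ (Prod.swap : ℝ × ℝ → ℝ × ℝ) := contDiff_snd.prodMk contDiff_fst
  have hm : MeasurePreserving (Prod.swap : ℝ × ℝ → ℝ × ℝ) volume volume :=
    Measure.measurePreserving_swap
  refine ⟨((Equiv.prodComm ℝ ℝ).trans Φ).trans (Equiv.prodComm ℝ ℝ),
    ⟨hs.comp (h1.comp hs), hs.comp (h2.comp hs), hm.comp (h3.comp hm), R, fun x hx => ?_⟩,
    fun s => ?_⟩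
  · have hx' : R ≤ ‖x.swap‖ := by
      rwa [Prod.norm_def, Prod.fst_swap, Prod.snd_swap, max_comm, ← Prod.norm_def]
    simp [h4 _ hx']
  · simp [h s]

/-- Vertical shears depending on the point link families of points. -/
lemma vertical (f : P → ℝ → ℝ) (hf : ∀ s, ContDiff ℝ ∞ (f s)) {R : ℝ} (hp : ∀ s, ‖p s‖ ≤ R)
    {δ : ℝ} (hδ : 0 < δ) (hsep : ∀ s t, f s = f t ∨ δ ≤ |(p s).1 - (p t).1|) :
    Linked p (fun s => ((p s).1, (p s).2 + f s (p s).1)) := by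
  obtain ⟨g, hg, hgf⟩ := exists_contDiff_eq_of_separated (fun s => (p s).1) f hf hδ hsep
  obtain ⟨Φ, hΦ, h⟩ := exists_eq_vertical_shear hg R
  exact ⟨Φ, hΦ, fun s => by rw [h _ (hp s), hgf]⟩

/-- Horizontal shears depending on the point link families of points. -/
lemma horizontal (f : P → ℝ → ℝ) (hf : ∀ s, ContDiff ℝ ∞ (f s)) {R : ℝ} (hp : ∀ s, ‖p s‖ ≤ R)
    {δ : ℝ} (hδ : 0 < δ) (hsep : ∀ s t, f s = f t ∨ δ ≤ |(p s).2 - (p t).2|) :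
    Linked p (fun s => ((p s).1 + f s (p s).2, (p s).2)) :=
  (vertical (p := fun s => (p s).swap) f hf (R := R)
    (fun s => by
      rw [Prod.norm_def, Prod.fst_swap, Prod.snd_swap, max_comm, ← Prod.norm_def]
      exact hp s) hδ hsep).swap

end Linked

/-- The number with the given sequence of ternary digits, doubled. -/
noncomputable def triSum (a : ℕ → ℝ) : ℝ := ∑' i : ℕ, 2 * a i * ((3 : ℝ)⁻¹) ^ (i + 1)

lemma summable_triSum {a : ℕ → ℝ} (ha : ∀ i, |a i| ≤ 1) :
    Summable fun i : ℕ => 2 * a i * ((3 : ℝ)⁻¹) ^ (i + 1) := by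
  have hg : Summable fun i : ℕ => (2 : ℝ) * ((3 : ℝ)⁻¹) ^ i :=
    (summable_geometric_of_lt_one (by norm_num) (by norm_num)).mul_left 2
  refine hg.of_norm_bounded fun i => ?_
  have h3 : (0 : ℝ) ≤ (3 : ℝ)⁻¹ ^ i := by positivity
  rw [Real.norm_eq_abs, abs_mul, abs_mul, abs_two,
    abs_of_nonneg (show (0 : ℝ) ≤ (3 : ℝ)⁻¹ ^ (i + 1) by positivity), pow_succ]
  nlinarith [mul_le_mul_of_nonneg_right (ha i) h3]

lemma triSum_succ {a : ℕ → ℝ} (ha : ∀ i, |a i| ≤ 1) :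
    triSum a = (2 * a 0 + triSum fun i => a (i + 1)) / 3 := by
  unfold triSum
  rw [(summable_triSum ha).tsum_eq_zero_add]
  have : ∀ i : ℕ, 2 * a (i + 1) * (3 : ℝ)⁻¹ ^ (i + 1 + 1) =
      2 * a (i + 1) * (3 : ℝ)⁻¹ ^ (i + 1) * 3⁻¹ := fun i => by rw [pow_succ]; ring
  simp only [this, tsum_mul_right]
  ring

lemma triSum_sub {a b : ℕ → ℝ} (ha : ∀ i, |a i| ≤ 1) (hb : ∀ i, |b i| ≤ 1) :
    triSum (fun i => a i - b i) = triSum a - triSum b := by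
  unfold triSum
  rw [← (summable_triSum ha).tsum_sub (summable_triSum hb)]
  exact tsum_congr fun i => by ring

lemma triSum_mem_Icc {a : ℕ → ℝ} (ha : ∀ i, a i ∈ Icc (0 : ℝ) 1) : triSum a ∈ Icc (0 : ℝ) 1 := by
  have hg : HasSum (fun i : ℕ => (2 : ℝ) / 3 * ((3 : ℝ)⁻¹) ^ i) (2 / 3 * (1 - 3⁻¹)⁻¹) :=
    (hasSum_geometric_of_lt_one (by norm_num) (by norm_num)).mul_left _
  refine ⟨tsum_nonneg fun i => ?_, ?_⟩
  · have := (ha i).1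
    positivity
  · have hle : triSum a ≤ ∑' i : ℕ, (2 : ℝ) / 3 * ((3 : ℝ)⁻¹) ^ i := by
      refine (summable_triSum fun i => ?_).tsum_le_tsum (fun i => ?_) hg.summable
      · exact abs_le.2 ⟨by linarith [(ha i).1], (ha i).2⟩
      · have h3 : (0 : ℝ) ≤ (3 : ℝ)⁻¹ ^ i := by positivity
        rw [pow_succ]
        nlinarith [(ha i).2]
    rw [hg.tsum_eq] at hle
    norm_num at hle
    exact hle

/-- Digit sequences in `{0, 1}` that differ at an early place give separated numbers. -/
lemma pow_le_abs_triSum_sub (M : ℕ) : ∀ {a b : ℕ → Fin 2}, (∃ i < M, a i ≠ b i) →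
    ((3 : ℝ)⁻¹) ^ M ≤ |triSum (fun i => ((a i : ℕ) : ℝ)) - triSum (fun i => ((b i : ℕ) : ℝ))| := by
  have hI : ∀ (a : ℕ → Fin 2) (i : ℕ), ((a i : ℕ) : ℝ) ∈ Icc (0 : ℝ) 1 := fun a i =>
    ⟨by positivity, by exact_mod_cast Nat.lt_succ_iff.1 (a i).2⟩
  have hB : ∀ (a : ℕ → Fin 2) (i : ℕ), |((a i : ℕ) : ℝ)| ≤ 1 := fun a i =>
    abs_le.2 ⟨by linarith [(hI a i).1], (hI a i).2⟩
  induction M with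
  | zero => rintro a b ⟨i, hi, -⟩; omega
  | succ M ih =>
    rintro a b ⟨i, hi, hne⟩
    rw [triSum_succ (hB a), triSum_succ (hB b), pow_succ]
    have hp : (3 : ℝ)⁻¹ ^ M ≤ 1 := pow_le_one₀ (by norm_num) (by norm_num)
    by_cases h0 : a 0 = b 0
    · obtain ⟨i, rfl⟩ : ∃ j, i = j + 1 := Nat.exists_eq_succ_of_ne_zero (by rintro rfl; exact hne h0)
      have := ih (a := fun i => a (i + 1)) (b := fun i => b (i + 1)) ⟨i, by omega, hne⟩
      rw [h0, ← sub_div, add_sub_add_left_eq_sub, abs_div, abs_of_pos (three_pos (α := ℝ)),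
        ← div_eq_mul_inv]
      gcongr
    · have h1 := triSum_mem_Icc (hI fun i => a (i + 1))
      have h2 := triSum_mem_Icc (hI fun i => b (i + 1))
      have hv : (((a 0 : ℕ) : ℝ) = 0 ∧ ((b 0 : ℕ) : ℝ) = 1) ∨
          (((a 0 : ℕ) : ℝ) = 1 ∧ ((b 0 : ℕ) : ℝ) = 0) := by
        generalize a 0 = u at *
        generalize b 0 = v at *
        fin_cases u <;> fin_cases v <;> simp_all
      rw [le_abs]
      rcases hv with ⟨e1, e2⟩ | ⟨e1, e2⟩
      · right
        rw [e1, e2]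
        linarith [h1.2, h2.1]
      · left
        rw [e1, e2]
        linarith [h1.1, h2.2]

lemma triSum_shift_nat (k : ℕ) : ∀ {d : ℤ → ℝ}, (∀ i, |d i| ≤ 1) →
    (∀ i : ℤ, 0 ≤ i → i < k → d i = 0) →
    triSum (fun i => d (i + k)) = 3 ^ k * triSum (fun i => d i) := by
  induction k with
  | zero => intro d _ _; simp
  | succ k ih =>
    intro d hd h0
    have h := ih hd fun i hi hk => h0 i hi (by push_cast; omega)
    have hs := triSum_succ (a := fun i => d (i + k)) fun i => hd _
    rw [pow_succ, mul_right_comm, ← h, hs, h0 _ (by positivity) (by simp)]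
    rw [mul_zero, zero_add, div_mul_cancel₀ _ three_ne_zero]
    congr 1
    ext i
    push_cast
    ring_nf

lemma triSum_shift (k : ℤ) {d : ℤ → ℝ} (hd : ∀ i, |d i| ≤ 1)
    (h0 : ∀ i : ℤ, -|k| ≤ i → i < |k| → d i = 0) :
    triSum (fun i => d (i + k)) = 3 ^ k * triSum (fun i => d i) := by
  obtain ⟨n, rfl | rfl⟩ := k.eq_nat_or_neg
  · rw [zpow_natCast]
    refine triSum_shift_nat n hd fun i hi hn => h0 i ?_ ?_ <;> simp <;> omega
  · have h := triSum_shift_nat n (d := fun i => d (i - n)) (fun i => hd _)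
      fun i hi hn => h0 _ (by simp; omega) (by simp; omega)
    simp only [add_sub_cancel_right, ← sub_eq_add_neg] at h ⊢
    rw [h, zpow_neg, zpow_natCast, ← mul_assoc, inv_mul_cancel₀ (by positivity), one_mul]

lemma digit_mem_Icc (u : Fin 2) : ((u : ℕ) : ℝ) ∈ Icc (0 : ℝ) 1 :=
  ⟨by positivity, by exact_mod_cast Nat.lt_succ_iff.1 u.2⟩

lemma cantorEnc_fst (s : ℤ → Fin 2) :
    (cantorEnc s).1 = triSum fun i => ((s (-(i + 1 : ℕ) : ℤ) : ℕ) : ℝ) := rfl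

lemma cantorEnc_snd (s : ℤ → Fin 2) :
    (cantorEnc s).2 = triSum fun i => ((s (i : ℤ) : ℕ) : ℝ) := rfl

lemma cantorEnc_fst_mem (s : ℤ → Fin 2) : (cantorEnc s).1 ∈ Icc (0 : ℝ) 1 :=
  triSum_mem_Icc fun _ => digit_mem_Icc _

lemma cantorEnc_snd_mem (s : ℤ → Fin 2) : (cantorEnc s).2 ∈ Icc (0 : ℝ) 1 :=
  triSum_mem_Icc fun _ => digit_mem_Icc _

lemma cantorEnc_fst_separated {s t : ℤ → Fin 2} {M : ℕ}
    (h : ∃ i : ℤ, -M ≤ i ∧ i < 0 ∧ s i ≠ t i) :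
    ((3 : ℝ)⁻¹) ^ M ≤ |(cantorEnc s).1 - (cantorEnc t).1| := by
  obtain ⟨i, h1, h2, h3⟩ := h
  have he : (-((-i - 1).toNat + 1 : ℕ) : ℤ) = i := by push_cast; omega
  exact pow_le_abs_triSum_sub M (a := fun i => s (-(i + 1 : ℕ) : ℤ))
    (b := fun i => t (-(i + 1 : ℕ) : ℤ)) ⟨(-i - 1).toNat, by omega, by rwa [he]⟩

lemma cantorEnc_snd_separated {s t : ℤ → Fin 2} {M : ℕ}
    (h : ∃ i : ℤ, 0 ≤ i ∧ i < M ∧ s i ≠ t i) :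
    ((3 : ℝ)⁻¹) ^ M ≤ |(cantorEnc s).2 - (cantorEnc t).2| := by
  obtain ⟨i, h1, h2, h3⟩ := h
  have he : (i.toNat : ℤ) = i := by omega
  exact pow_le_abs_triSum_sub M (a := fun i => s (i : ℤ))
    (b := fun i => t (i : ℤ)) ⟨i.toNat, by omega, by rwa [he]⟩

/-- The restrictions of sequences to a window can be numbered by a bounded set of naturals. -/
lemma exists_window_code (l r : ℤ) : ∃ (a : (ℤ → Fin 2) → ℕ) (N : ℕ), (∀ s, a s ≤ N) ∧
    ∀ s t, a s = a t ↔ ∀ i, l ≤ i → i < r → s i = t i := by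
  obtain ⟨N, ⟨e⟩⟩ := Finite.exists_equiv_fin (Finset.Ico l r → Fin 2)
  refine ⟨fun s => e fun i => s i, N, fun s => (e _).2.le, fun s t => ?_⟩
  rw [Fin.val_inj, e.apply_eq_iff_eq, funext_iff, Subtype.forall]
  simp [Finset.mem_Ico]

lemma one_le_abs_sub_of_ne {x y L D : ℝ} {m n : ℕ} (hmn : m ≠ n) (hxy : |x - y| ≤ D)
    (hL : D + 1 ≤ L) : 1 ≤ |x + L * m - (y + L * n)| := by
  have h1 := abs_le.1 hxy
  have hL0 : 0 ≤ L := by linarith [abs_nonneg (x - y)]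
  rw [le_abs]
  rcases Nat.lt_or_gt_of_ne hmn with h | h
  · right
    have : (m : ℝ) + 1 ≤ n := by exact_mod_cast h
    nlinarith [mul_le_mul_of_nonneg_left this hL0]
  · left
    have : (n : ℝ) + 1 ≤ m := by exact_mod_cast h
    nlinarith [mul_le_mul_of_nonneg_left this hL0]

lemma abs_sub_le_one {x y : ℝ} (hx : x ∈ Icc (0 : ℝ) 1) (hy : y ∈ Icc (0 : ℝ) 1) :
    |x - y| ≤ 1 := abs_le.2 ⟨by linarith [hx.1, hy.2], by linarith [hx.2, hy.1]⟩

lemma norm_le_of_abs_le {p : ℝ × ℝ} {R : ℝ} (h1 : |p.1| ≤ R) (h2 : |p.2| ≤ R) : ‖p‖ ≤ R :=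
  max_le h1 h2

/-- Pieces of the Cantor square can be pulled apart along the diagonal. -/
lemma linked_spread {P : Type*} (ψ : P → ℤ → Fin 2) (n : P → ℕ) {N M : ℕ} (hn : ∀ s, n s ≤ N)
    (hne : ∀ s t, n s ≠ n t → ∃ i : ℤ, -M ≤ i ∧ i < M ∧ ψ s i ≠ ψ t i) {L : ℝ} (hL : 2 ≤ L) :
    Linked (fun s => cantorEnc (ψ s)) (fun s => cantorEnc (ψ s) + (L * n s, L * n s)) := by
  obtain ⟨a, A, hA, ha⟩ := exists_window_code (-M) 0
  have hδ : (0 : ℝ) < (3 : ℝ)⁻¹ ^ M := by positivity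
  have hδ1 : (3 : ℝ)⁻¹ ^ M ≤ 1 := pow_le_one₀ (by norm_num) (by norm_num)
  have sep : ∀ s t, a (ψ s) = a (ψ t) ∨
      (3 : ℝ)⁻¹ ^ M ≤ |(cantorEnc (ψ s)).1 - (cantorEnc (ψ t)).1| := by
    intro s t
    by_cases h : a (ψ s) = a (ψ t)
    · exact Or.inl h
    · rw [ha] at h
      push Not at h
      exact Or.inr (cantorEnc_fst_separated h)
  have hx : ∀ s, |(cantorEnc (ψ s)).1| ≤ 1 := fun s =>
    abs_le.2 ⟨by linarith [(cantorEnc_fst_mem (ψ s)).1], (cantorEnc_fst_mem (ψ s)).2⟩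
  have hy : ∀ s, |(cantorEnc (ψ s)).2| ≤ 1 := fun s =>
    abs_le.2 ⟨by linarith [(cantorEnc_snd_mem (ψ s)).1], (cantorEnc_snd_mem (ψ s)).2⟩
  have hnL : ∀ s, |L * n s| ≤ L * N := fun s => by
    have : (n s : ℝ) ≤ N := by exact_mod_cast hn s
    rw [abs_of_nonneg (by positivity)]
    gcongr
  have haA : ∀ s, |2 * (a (ψ s) : ℝ)| ≤ 2 * A := fun s => by
    have : (a (ψ s) : ℝ) ≤ A := by exact_mod_cast hA _
    rw [abs_of_nonneg (by positivity)]
    gcongr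
  have hLN : 0 ≤ L * N := by positivity
  have hAA : (0 : ℝ) ≤ 2 * A := by positivity
  have step1 := Linked.vertical (p := fun s => cantorEnc (ψ s))
    (fun s _ => 2 * (a (ψ s) : ℝ)) (fun _ => contDiff_const) (R := 1)
    (fun s => norm_le_of_abs_le (hx s) (hy s)) hδ
    fun s t => (sep s t).imp_left fun h => by rw [h]
  have step2 := Linked.horizontal
    (p := fun s => ((cantorEnc (ψ s)).1, (cantorEnc (ψ s)).2 + 2 * (a (ψ s) : ℝ)))
    (fun s _ => L * n s) (fun _ => contDiff_const) (R := 1 + 2 * A)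
    (fun s => norm_le_of_abs_le ((hx s).trans (by linarith))
      ((abs_add_le _ _).trans (add_le_add (hy s) (haA s)))) hδ <| by
    intro s t
    by_cases h : n s = n t
    · left; rw [h]
    right
    by_cases h' : a (ψ s) = a (ψ t)
    · obtain ⟨i, h1, h2, h3⟩ := hne s t h
      have hi : 0 ≤ i := by
        by_contra hi
        exact h3 ((ha _ _).1 h' i h1 (by omega))
      simpa [h'] using cantorEnc_snd_separated ⟨i, hi, h2, h3⟩
    · exact hδ1.trans (one_le_abs_sub_of_ne h'
        (abs_sub_le_one (cantorEnc_snd_mem _) (cantorEnc_snd_mem _)) (by norm_num))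
  have step3 := Linked.vertical
    (p := fun s => ((cantorEnc (ψ s)).1 + L * n s, (cantorEnc (ψ s)).2 + 2 * (a (ψ s) : ℝ)))
    (fun s _ => L * n s - 2 * (a (ψ s) : ℝ)) (fun _ => contDiff_const) (R := 1 + 2 * A + L * N)
    (fun s => norm_le_of_abs_le
      ((abs_add_le _ _).trans (by linarith [hx s, hnL s]))
      ((abs_add_le _ _).trans (by linarith [hy s, haA s]))) hδ <| by
    intro s t
    by_cases h : n s = n t
    · refine (sep s t).imp (fun h' => by rw [h, h']) fun h' => ?_
      simpa [h] using h'
    · right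
      exact hδ1.trans (one_le_abs_sub_of_ne h
        (abs_sub_le_one (cantorEnc_fst_mem _) (cantorEnc_fst_mem _)) (by linarith))
  convert (step1.trans step2).trans step3 using 2 with s
  ext <;> simp

/-- Pieces of the plane that lie far apart along the diagonal can be sheared vertically,
independently of each other. -/
lemma linked_vertical_of_far {P : Type*} (q : P → ℝ × ℝ) (n : P → ℕ) {N : ℕ} (hn : ∀ s, n s ≤ N)
    {R L : ℝ} (hq : ∀ s, ‖q s‖ ≤ R) (hL : 2 * R + 1 ≤ L) (f : P → ℝ → ℝ)
    (hf : ∀ s, ContDiff ℝ ∞ (f s)) (hfn : ∀ s t, n s = n t → f s = f t) :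
    Linked (fun s => q s + (L * n s, L * n s))
      (fun s => ((q s).1, (q s).2 + f s (q s).1) + (L * n s, L * n s)) := by
  have h := Linked.vertical (p := fun s => q s + (L * n s, L * n s))
    (fun s x => f s (x - L * n s)) (fun s => (hf s).comp (contDiff_id.sub contDiff_const))
    (R := R + |L| * N) (fun s => ?_) one_pos fun s t => ?_
  · convert h using 2 with s
    ext
    · simp
    · simp only [Prod.fst_add, Prod.snd_add, add_sub_cancel_right]
      ring
  · refine (norm_add_le _ _).trans (add_le_add (hq s) (norm_le_of_abs_le ?_ ?_)) <;>
    · have : (n s : ℝ) ≤ N := by exact_mod_cast hn s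
      rw [abs_mul, Nat.abs_cast]
      gcongr
  · by_cases hst : n s = n t
    · left
      rw [hst, hfn s t hst]
    · right
      refine one_le_abs_sub_of_ne hst (D := 2 * R) ?_ hL
      have h1 : |(q s).1| ≤ R := (le_max_left _ _).trans (hq s)
      have h2 : |(q t).1| ≤ R := (le_max_left _ _).trans (hq t)
      exact (abs_sub _ _).trans (by linarith)

/-- Pieces of the plane that lie far apart along the diagonal can be sheared horizontally,
independently of each other. -/
lemma linked_horizontal_of_far {P : Type*} (q : P → ℝ × ℝ) (n : P → ℕ) {N : ℕ}
    (hn : ∀ s, n s ≤ N) {R L : ℝ} (hq : ∀ s, ‖q s‖ ≤ R) (hL : 2 * R + 1 ≤ L) (f : P → ℝ → ℝ)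
    (hf : ∀ s, ContDiff ℝ ∞ (f s)) (hfn : ∀ s t, n s = n t → f s = f t) :
    Linked (fun s => q s + (L * n s, L * n s))
      (fun s => ((q s).1 + f s (q s).2, (q s).2) + (L * n s, L * n s)) :=
  (linked_vertical_of_far (fun s => (q s).swap) n hn (R := R)
    (fun s => by
      rw [Prod.norm_def, Prod.fst_swap, Prod.snd_swap, max_comm, ← Prod.norm_def]
      exact hq s) hL f hf hfn).swap

namespace GenShift

/-- The amount by which a generalized shift translates a sequence. -/
def amount (φ : GenShift (Fin 2)) (s : ℤ → Fin 2) : ℤ := φ.F fun i => s i.1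

lemma apply_of_notMem (φ : GenShift (Fin 2)) (s : ℤ → Fin 2) {i : ℤ}
    (hi : i + φ.amount s ∉ φ.DG) : φ.apply s i = s (i + φ.amount s) :=
  dif_neg hi

/-- A window containing everything a generalized shift looks at. -/
structure IsWindow (φ : GenShift (Fin 2)) (m : ℕ) : Prop where
  mem_of_DF : ∀ i ∈ φ.DF, -(m : ℤ) ≤ i ∧ i < m
  mem_of_DG : ∀ i ∈ φ.DG, -(m : ℤ) ≤ i ∧ i < m
  abs_amount_le : ∀ s, |φ.amount s| ≤ m

lemma exists_isWindow (φ : GenShift (Fin 2)) : ∃ m, φ.IsWindow m := by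
  obtain ⟨K, hK⟩ := Finite.exists_le fun w => (φ.F w).natAbs
  obtain ⟨b, hb⟩ := Finite.exists_le fun i : φ.DF => i.1.natAbs
  obtain ⟨c, hc⟩ := Finite.exists_le fun i : φ.DG => i.1.natAbs
  refine ⟨K + b + c + 1, fun i hi => ?_, fun i hi => ?_, fun s => ?_⟩
  · have := hb ⟨i, hi⟩
    simp only at this
    omega
  · have := hc ⟨i, hi⟩
    simp only at this
    omega
  · have := hK fun i => s i.1
    rw [amount, Int.abs_eq_natAbs]
    omega

/-- Agreement of two sequences on a window. -/
def Agree (m : ℕ) (s t : ℤ → Fin 2) : Prop := ∀ i : ℤ, -(m : ℤ) ≤ i → i < m → s i = t i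

variable {φ : GenShift (Fin 2)} {m : ℕ} {s t : ℤ → Fin 2}

lemma IsWindow.amount_eq (hm : φ.IsWindow m) (h : Agree m s t) : φ.amount s = φ.amount t :=
  congrArg φ.F <| funext fun i => h _ (hm.mem_of_DF i i.2).1 (hm.mem_of_DF i i.2).2

lemma IsWindow.apply_eq (hm : φ.IsWindow m) (h : Agree m s t) {i : ℤ}
    (h1 : -(m : ℤ) ≤ i + φ.amount s) (h2 : i + φ.amount s < m) : φ.apply s i = φ.apply t i := by
  have ha := hm.amount_eq h
  have hG : (fun i : { i // i ∈ φ.DG } => s i.1) = fun i => t i.1 :=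
    funext fun i => h _ (hm.mem_of_DG i i.2).1 (hm.mem_of_DG i i.2).2
  by_cases hi : i + φ.amount s ∈ φ.DG
  · have hi' : i + φ.amount t ∈ φ.DG := ha ▸ hi
    have e1 : φ.apply s i = φ.G (fun i => s i.1) ⟨_, hi⟩ := dif_pos hi
    have e2 : φ.apply t i = φ.G (fun i => t i.1) ⟨_, hi'⟩ := dif_pos hi'
    rw [e1, e2, hG]
    congr 2
    rw [ha]
  · rw [φ.apply_of_notMem s hi, φ.apply_of_notMem t (ha ▸ hi), ← ha]
    exact h _ h1 h2

/-- For an injective generalized shift, images determine the windows of their preimages. -/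
lemma IsWindow.agree_of_apply (hm : φ.IsWindow m) (hφ : Function.Injective φ.apply)
    (h : Agree (2 * m) (φ.apply s) (φ.apply t)) : Agree m s t := by
  let t' : ℤ → Fin 2 := fun i =>
    if -(m : ℤ) ≤ i ∧ i < m then t i else φ.apply s (i - φ.amount t)
  have ht : Agree m t' t := fun i h1 h2 => if_pos ⟨h1, h2⟩
  have ha := hm.amount_eq ht
  have hb := abs_le.1 (hm.abs_amount_le t)
  have e : φ.apply t' = φ.apply s := by
    funext i
    by_cases hi : -(m : ℤ) ≤ i + φ.amount t ∧ i + φ.amount t < m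
    · rw [hm.apply_eq ht (by omega) (by omega), h i (by push_cast; omega) (by push_cast; omega)]
    · rw [φ.apply_of_notMem t' fun hc => hi (ha ▸ hm.mem_of_DG _ hc), ha]
      simp only [t', if_neg hi, add_sub_cancel_right]
  have := hφ e
  exact fun i h1 h2 => by rw [← this, ht i h1 h2]

lemma IsWindow.digit_sub (hm : φ.IsWindow m) (h : Agree m s t) (i : ℤ) :
    ((φ.apply s i : ℕ) : ℝ) - ((φ.apply t i : ℕ) : ℝ) =
      ((s (i + φ.amount s) : ℕ) : ℝ) - ((t (i + φ.amount s) : ℕ) : ℝ) := by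
  have ha := hm.amount_eq h
  by_cases hi : -(m : ℤ) ≤ i + φ.amount s ∧ i + φ.amount s < m
  · rw [hm.apply_eq h hi.1 hi.2, h _ hi.1 hi.2, sub_self, sub_self]
  · rw [φ.apply_of_notMem s fun hc => hi (hm.mem_of_DG _ hc),
      φ.apply_of_notMem t fun hc => hi (ha ▸ hm.mem_of_DG _ hc), ← ha]

lemma abs_digit_le (u : Fin 2) : |((u : ℕ) : ℝ)| ≤ 1 :=
  abs_le.2 ⟨by linarith [(digit_mem_Icc u).1], (digit_mem_Icc u).2⟩

/-- On a cylinder, a generalized shift scales the second coordinate. -/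
lemma IsWindow.cantorEnc_snd_sub (hm : φ.IsWindow m) (h : Agree m s t) :
    (cantorEnc (φ.apply s)).2 - (cantorEnc (φ.apply t)).2 =
      3 ^ φ.amount s * ((cantorEnc s).2 - (cantorEnc t).2) := by
  simp only [cantorEnc_snd]
  have hb := hm.abs_amount_le s
  rw [← triSum_sub (fun _ => abs_digit_le _) (fun _ => abs_digit_le _),
    ← triSum_sub (fun _ => abs_digit_le _) (fun _ => abs_digit_le _)]
  simp only [hm.digit_sub h]
  refine triSum_shift (φ.amount s) (d := fun i => ((s i : ℕ) : ℝ) - ((t i : ℕ) : ℝ))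
    (fun i => abs_sub_le_one (digit_mem_Icc _) (digit_mem_Icc _)) fun i h1 h2 => ?_
  rw [h i (by omega) (by omega), sub_self]

/-- On a cylinder, a generalized shift scales the first coordinate. -/
lemma IsWindow.cantorEnc_fst_sub (hm : φ.IsWindow m) (h : Agree m s t) :
    (cantorEnc (φ.apply s)).1 - (cantorEnc (φ.apply t)).1 =
      3 ^ (-φ.amount s) * ((cantorEnc s).1 - (cantorEnc t).1) := by
  simp only [cantorEnc_fst]
  have hb := hm.abs_amount_le s
  rw [← triSum_sub (fun _ => abs_digit_le _) (fun _ => abs_digit_le _),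
    ← triSum_sub (fun _ => abs_digit_le _) (fun _ => abs_digit_le _)]
  simp only [hm.digit_sub h]
  have key := triSum_shift (-φ.amount s)
    (d := fun i => ((s (-(i + 1)) : ℕ) : ℝ) - ((t (-(i + 1)) : ℕ) : ℝ))
    (fun i => abs_sub_le_one (digit_mem_Icc _) (digit_mem_Icc _)) fun i h1 h2 => by
      rw [abs_neg] at h1 h2
      have hs : i + 1 ≤ |φ.amount s| := by omega
      rcases eq_or_lt_of_le (abs_nonneg (φ.amount s)) with h0 | h0
      · omega
      rw [h _ (by omega) (by omega), sub_self]
  have e : ∀ i : ℕ, (-((i + 1 : ℕ) : ℤ)) + φ.amount s = -((i : ℤ) + -φ.amount s + 1) := fun i => by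
    push_cast; ring
  simp only [e]
  simpa using key

end GenShift

/-- An injective generalized shift is realized on the Cantor square by a boundedly supported
area-preserving diffeomorphism. -/
lemma GenShift.linked_cantorEnc (φ : GenShift (Fin 2)) (hφ : Function.Injective φ.apply) :
    Linked cantorEnc (fun s => cantorEnc (φ.apply s)) := by
  obtain ⟨m, hm⟩ := φ.exists_isWindow
  obtain ⟨n, N, hN, hn⟩ := exists_window_code (-m) m
  have hagree : ∀ s t, n s = n t → Agree m s t := fun s t h => (hn s t).1 h
  let l : (ℤ → Fin 2) → ℝ := fun s => 3 ^ (-φ.amount s)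
  have hl : ∀ s, 0 < l s := fun s => by positivity
  have hl' : ∀ s, (l s)⁻¹ = 3 ^ φ.amount s := fun s => by simp [l]
  let W : ℝ := 3 ^ m
  have hlW : ∀ s, l s ≤ W ∧ (l s)⁻¹ ≤ W := by
    intro s
    have h := abs_le.1 (hm.abs_amount_le s)
    rw [hl' s]
    simp only [l, W, ← zpow_natCast]
    exact ⟨zpow_le_zpow_right₀ (by norm_num) (by omega),
      zpow_le_zpow_right₀ (by norm_num) (by omega)⟩
  have hW : 1 ≤ W := one_le_pow₀ (by norm_num)
  let tx : (ℤ → Fin 2) → ℝ := fun s => (cantorEnc (φ.apply s)).1 - l s * (cantorEnc s).1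
  let ty : (ℤ → Fin 2) → ℝ := fun s => (cantorEnc (φ.apply s)).2 - (l s)⁻¹ * (cantorEnc s).2
  have hln : ∀ s t, n s = n t → l s = l t := fun s t h => by
    simp only [l, hm.amount_eq (hagree s t h)]
  have htx : ∀ s t, n s = n t → tx s = tx t := fun s t h => by
    have h1 := hm.cantorEnc_fst_sub (hagree s t h)
    have h2 := hln s t h
    change _ = l s * _ at h1
    simp only [tx, ← h2]
    linarith
  have hty : ∀ s t, n s = n t → ty s = ty t := fun s t h => by
    have h1 := hm.cantorEnc_snd_sub (hagree s t h)
    have h2 := hln s t h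
    rw [← hl'] at h1
    simp only [ty, ← h2]
    linarith
  have hx : ∀ s, |(cantorEnc s).1| ≤ 1 := fun s =>
    abs_le.2 ⟨by linarith [(cantorEnc_fst_mem s).1], (cantorEnc_fst_mem s).2⟩
  have hy : ∀ s, |(cantorEnc s).2| ≤ 1 := fun s =>
    abs_le.2 ⟨by linarith [(cantorEnc_snd_mem s).1], (cantorEnc_snd_mem s).2⟩
  let y₁ : (ℤ → Fin 2) → ℝ := fun s => (cantorEnc s).2 + (l s - 1) * (cantorEnc s).1
  let x₂ : (ℤ → Fin 2) → ℝ := fun s => (cantorEnc s).1 + y₁ s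
  have hy₁ : ∀ s, |y₁ s| ≤ 1 + W := fun s => by
    refine (abs_add_le _ _).trans (add_le_add (hy s) ?_)
    rw [abs_mul]
    have : |l s - 1| ≤ W := abs_le.2 ⟨by linarith [hl s], by linarith [(hlW s).1]⟩
    nlinarith [hx s, abs_nonneg (cantorEnc s).1]
  have hx₂ : ∀ s, |x₂ s| ≤ 2 + W := fun s =>
    (abs_add_le _ _).trans (by linarith [hx s, hy₁ s])
  let L : ℝ := 2 * (2 + W) + 1
  have hL : 2 ≤ L := by simp only [L]; linarith
  have step0 := linked_spread id n hN (M := m) (fun s t h => by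
    have := (not_congr (hn s t)).1 h
    push Not at this
    exact this) hL
  have step1 := linked_vertical_of_far cantorEnc n hN (R := 2 + W) (L := L)
    (fun s => norm_le_of_abs_le (by linarith [hx s]) (by linarith [hy s])) le_rfl
    (fun s x => (l s - 1) * x) (fun s => contDiff_const.mul contDiff_id)
    (fun s t h => by rw [hln s t h])
  have step2 := linked_horizontal_of_far (fun s => ((cantorEnc s).1, y₁ s)) n hN (R := 2 + W)
    (L := L) (fun s => norm_le_of_abs_le (by linarith [hx s]) (by linarith [hy₁ s])) le_rfl
    (fun s y => y) (fun s => contDiff_id) (fun s t h => rfl)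
  have step3 := linked_vertical_of_far (fun s => (x₂ s, y₁ s)) n hN (R := 2 + W) (L := L)
    (fun s => norm_le_of_abs_le (hx₂ s) (by linarith [hy₁ s])) le_rfl
    (fun s x => ((l s)⁻¹ - 1) * x + ty s)
    (fun s => (contDiff_const.mul contDiff_id).add contDiff_const)
    (fun s t h => by rw [hln s t h, hty s t h])
  have step4 := linked_horizontal_of_far (fun s => (x₂ s, (cantorEnc (φ.apply s)).2)) n hN
    (R := 2 + W) (L := L)
    (fun s => norm_le_of_abs_le (hx₂ s) (by linarith [hy (φ.apply s)])) le_rfl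
    (fun s y => -l s * (y - ty s) + tx s)
    (fun s => (contDiff_const.mul (contDiff_id.sub contDiff_const)).add contDiff_const)
    (fun s t h => by rw [hln s t h, hty s t h, htx s t h])
  have step5 := linked_spread φ.apply n hN (M := 2 * m) (fun s t h => by
    by_contra! hc
    refine h ((hn s t).2 (hm.agree_of_apply hφ fun i h1 h2 => ?_))
    exact hc i h1 h2) hL
  have e3 : ∀ s, y₁ s + (((l s)⁻¹ - 1) * x₂ s + ty s) = (cantorEnc (φ.apply s)).2 := fun s => by
    have := (hl s).ne'
    simp only [x₂, y₁, ty]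
    field_simp
    ring
  have e4 : ∀ s, x₂ s + (-l s * ((cantorEnc (φ.apply s)).2 - ty s) + tx s) =
      (cantorEnc (φ.apply s)).1 := fun s => by
    have := (hl s).ne'
    simp only [x₂, y₁, ty, tx]
    field_simp
    ring
  simp only [e3] at step3
  simp only [e4] at step4
  exact ((((step0.trans step1).trans step2).trans step3).trans step4).trans step5.symm

/-- Conjugating an area-preserving map by a homothety. -/
lemma MeasureTheory.MeasurePreserving.homothety_conj {f : ℝ × ℝ → ℝ × ℝ}
    (hf : MeasurePreserving f volume volume) {ρ : ℝ} (hρ : ρ ≠ 0) :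
    MeasurePreserving (fun x => ρ • f (ρ⁻¹ • x)) volume volume := by
  have hm : Measurable fun x : ℝ × ℝ => ρ • f (ρ⁻¹ • x) :=
    (hf.measurable.comp (measurable_const_smul ρ⁻¹)).const_smul ρ
  refine ⟨hm, ?_⟩
  ext s hs
  rw [Measure.map_apply hm hs]
  have hs' : MeasurableSet ((fun x : ℝ × ℝ => ρ • x) ⁻¹' s) := measurable_const_smul ρ hs
  have e : (fun x : ℝ × ℝ => ρ • f (ρ⁻¹ • x)) ⁻¹' s =
      (fun x => ρ⁻¹ • x) ⁻¹' (f ⁻¹' ((fun x => ρ • x) ⁻¹' s)) := rfl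
  rw [e, Measure.addHaar_preimage_smul _ (inv_ne_zero hρ),
    hf.measure_preimage hs'.nullMeasurableSet, Measure.addHaar_preimage_smul _ hρ, ← mul_assoc,
    ← ENNReal.ofReal_mul (abs_nonneg _), ← abs_mul, inv_pow, inv_inv,
    mul_inv_cancel₀ (pow_ne_zero _ hρ), abs_one, ENNReal.ofReal_one, one_mul]

/-- Every bijective generalized shift on `{0,1}` extends to a smooth area-preserving
diffeomorphism of the plane that is the identity outside the open unit disk and whose
restriction to (an affine copy of) the square Cantor set is conjugate to `φ`. -/
theorem statement4 (φ : GenShift (Fin 2)) (hφ : Function.Bijective φ.apply) :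
    ∃ Φ : (ℝ × ℝ) ≃ (ℝ × ℝ),
      ContDiff ℝ (⊤ : ℕ∞) Φ ∧
      ContDiff ℝ (⊤ : ℕ∞) Φ.symm ∧
      MeasureTheory.MeasurePreserving Φ MeasureTheory.volume MeasureTheory.volume ∧
      (∀ x ∉ unitDisk, Φ x = x) ∧
      ∃ (c : ℝ × ℝ) (ρ : ℝ), 0 < ρ ∧
        (∀ z ∈ (Set.Icc (0 : ℝ) 1) ×ˢ (Set.Icc (0 : ℝ) 1), c + ρ • z ∈ unitDisk) ∧
        ∀ s : ℤ → Fin 2, Φ (c + ρ • cantorEnc s) = c + ρ • cantorEnc (φ.apply s) := by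
  obtain ⟨Ψ, ⟨h1, h2, h3, R, h4⟩, hΨ⟩ := φ.linked_cantorEnc hφ.injective
  let S : ℝ := max R 1
  have hS : 1 ≤ S := le_max_right _ _
  have hS0 : 0 < S := by linarith
  let ρ : ℝ := (2 * S)⁻¹
  have hρ : 0 < ρ := by positivity
  have hρS : ρ * (2 * S) = 1 := inv_mul_cancel₀ (by positivity)
  have hρ1 : ρ ≤ 1 / 2 := by nlinarith
  let σ : (ℝ × ℝ) ≃ (ℝ × ℝ) := (Homeomorph.smulOfNeZero ρ hρ.ne').toEquiv
  have hσ : ∀ x, σ x = ρ • x := fun _ => rfl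
  have hσ' : ∀ x, σ.symm x = ρ⁻¹ • x := fun _ => rfl
  have cσ : ContDiff ℝ ∞ σ := contDiff_id.const_smul ρ
  have cσ' : ContDiff ℝ ∞ σ.symm := contDiff_id.const_smul ρ⁻¹
  refine ⟨σ.symm.trans (Ψ.trans σ), cσ.comp (h1.comp cσ'), cσ.comp (h2.comp cσ'),
    h3.homothety_conj hρ.ne', fun x hx => ?_, 0, ρ, hρ, ?_, fun s => ?_⟩
  · have hn : R ≤ ‖ρ⁻¹ • x‖ := by
      rw [norm_smul, norm_inv, Real.norm_of_nonneg hρ.le, show ρ⁻¹ = 2 * S from inv_inv _]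
      have hx1 : 1 ≤ x.1 ^ 2 + x.2 ^ 2 := not_lt.1 hx
      have ha : |x.1| ≤ ‖x‖ := norm_fst_le x
      have hb : |x.2| ≤ ‖x‖ := norm_snd_le x
      have hh : 1 / 2 ≤ ‖x‖ := by
        by_contra! hc
        nlinarith [sq_abs x.1, sq_abs x.2, abs_nonneg x.1, abs_nonneg x.2]
      have hR : R ≤ S := le_max_left _ _
      nlinarith
    simp only [Equiv.trans_apply, hσ, hσ']
    rw [h4 _ hn, smul_inv_smul₀ hρ.ne']
  · rintro ⟨x, y⟩ ⟨⟨hx0, hx1⟩, hy0, hy1⟩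
    simp only [unitDisk, zero_add, Prod.smul_mk, smul_eq_mul, mem_ofPred_eq]
    have ha : ρ * x ≤ 1 / 2 := by nlinarith
    have hb : ρ * y ≤ 1 / 2 := by nlinarith
    have ha0 : 0 ≤ ρ * x := by positivity
    have hb0 : 0 ≤ ρ * y := by positivity
    nlinarith
  · simp only [zero_add, Equiv.trans_apply, hσ, hσ']
    rw [inv_smul_smul₀ hρ.ne', hΨ]
end

section
/- For any two distinct configurations (q, t) ≠ (q', t') of a Turing machine T, the open intervals I_{(q,t)} and I_{(q',t')} (centered at φ_enc(q,t) and φ_enc(q',t') with lengths φ_enc(q,t)²/4 and φ_enc(q',t')²/4 respectively) are disjoint. -/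
/-- `r(t) = Σ_{i ≥ 0} t(i) 2^i`. -/
noncomputable def rEnc (t : Tape) : ℕ :=
  ∑ i ∈ t.support.filter (fun i => 0 ≤ i), ((t i : ℕ) * 2 ^ i.toNat)

/-- `s(t) = Σ_{i ≥ 1} t(−i) 2^{i−1}`. -/
noncomputable def sEnc (t : Tape) : ℕ :=
  ∑ i ∈ t.support.filter (fun i => i < 0), ((t i : ℕ) * 2 ^ (-i - 1).toNat)

/-- The encoding `φ_enc(q, t) = 1/(2^{q+1} 3^{r(t)} 5^{s(t)}) ∈ (0,1)`. -/
noncomputable def phiEnc {m : ℕ} (c : Config m) : ℝ :=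
  1 / (2 ^ ((c.1 : ℕ) + 1) * 3 ^ rEnc c.2 * 5 ^ sEnc c.2)

/-- The open interval `I_{(q,t)}` centered at `φ_enc(q,t)` of length `φ_enc(q,t)²/4`. -/
noncomputable def Iconf {m : ℕ} (c : Config m) : Set ℝ :=
  Set.Ioo (phiEnc c - phiEnc c ^ 2 / 8) (phiEnc c + phiEnc c ^ 2 / 8)

/-- Binary sums indexed by an injectively relabelled part of the support of a tape determine
which cells of that part are nonzero. -/
theorem Tape.mem_support_iff_of_binary_sum_eq {p : ℤ → Prop} [DecidablePred p] {f : ℤ → ℕ}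
    (hf : ∀ i j, p i → p j → f i = f j → i = j) {t t' : Tape}
    (h : ∑ i ∈ t.support.filter p, ((t i : ℕ) * 2 ^ f i) =
      ∑ i ∈ t'.support.filter p, ((t' i : ℕ) * 2 ^ f i)) {i : ℤ} (hi : p i) :
    i ∈ t.support ↔ i ∈ t'.support := by
  have key (u : Tape) : ∑ j ∈ u.support.filter p, ((u j : ℕ) * 2 ^ f j) =
      ∑ k ∈ (u.support.filter p).image f, 2 ^ k := by
    rw [Finset.sum_image]
    · refine Finset.sum_congr rfl fun j hj => ?_
      have hj' : u j ≠ 0 := Finsupp.mem_support_iff.mp (Finset.mem_filter.mp hj).1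
      rw [Fin.eq_one_of_ne_zero _ hj']
      simp
    · intro a ha b hb hab
      exact hf a b (Finset.mem_filter.mp ha).2 (Finset.mem_filter.mp hb).2 hab
  rw [key, key] at h
  have himage := Finset.geomSum_injective le_rfl h
  have mem_image (u : Tape) : f i ∈ (u.support.filter p).image f ↔ i ∈ u.support := by
    refine ⟨fun hmem => ?_, fun hmem =>
      Finset.mem_image_of_mem f (Finset.mem_filter.mpr ⟨hmem, hi⟩)⟩
    obtain ⟨j, hj, hji⟩ := Finset.mem_image.mp hmem
    obtain ⟨hj, hpj⟩ := Finset.mem_filter.mp hj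
    exact hf j i hpj hi hji ▸ hj
  rw [← mem_image t, ← mem_image t', himage]

theorem Tape.eq_of_rEnc_eq_of_sEnc_eq {t t' : Tape} (hr : rEnc t = rEnc t')
    (hs : sEnc t = sEnc t') : t = t' := by
  have hsupp (i : ℤ) : i ∈ t.support ↔ i ∈ t'.support := by
    rcases le_or_gt 0 i with hi | hi
    · exact mem_support_iff_of_binary_sum_eq (by intros; omega) hr hi
    · exact mem_support_iff_of_binary_sum_eq (by intros; omega) hs hi
  ext i : 1
  have := hsupp i
  rw [Finsupp.mem_support_iff, Finsupp.mem_support_iff] at this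
  generalize t i = a at *
  generalize t' i = b at *
  revert a b
  decide

theorem two_three_five_pow_injective {a b c a' b' c' : ℕ}
    (h : 2 ^ a * 3 ^ b * 5 ^ c = 2 ^ a' * 3 ^ b' * 5 ^ c') : a = a' ∧ b = b' ∧ c = c' := by
  have hfac (p : ℕ) := congrArg (fun n : ℕ => n.factorization p) h
  have h2 := hfac 2
  have h3 := hfac 3
  have h5 := hfac 5
  simp [Nat.factorization_mul, Nat.prime_two.factorization, Nat.prime_three.factorization,
    Nat.prime_five.factorization] at h2 h3 h5
  exact ⟨h2, h3, h5⟩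

/-- The integer `2^{q+1} 3^{r(t)} 5^{s(t)}` whose reciprocal is `phiEnc`. -/
noncomputable def godelNumber {m : ℕ} (c : Config m) : ℕ :=
  2 ^ ((c.1 : ℕ) + 1) * 3 ^ rEnc c.2 * 5 ^ sEnc c.2

theorem godelNumber_pos {m : ℕ} (c : Config m) : 0 < godelNumber c := by
  unfold godelNumber
  positivity

theorem godelNumber_injective {m : ℕ} :
    Function.Injective (godelNumber : Config m → ℕ) := by
  intro c c' h
  obtain ⟨hq, hr, hs⟩ := two_three_five_pow_injective h
  exact Prod.ext (Fin.ext (Nat.succ_injective hq)) (Tape.eq_of_rEnc_eq_of_sEnc_eq hr hs)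

theorem phiEnc_eq_one_div_godelNumber {m : ℕ} (c : Config m) :
    phiEnc c = 1 / (godelNumber c : ℝ) := by
  simp [phiEnc, godelNumber]

theorem one_div_add_sq_le_one_div_sub_sq {x y : ℝ} (hx : 1 ≤ x) (hxy : x + 1 ≤ y) :
    1 / y + (1 / y) ^ 2 / 8 ≤ 1 / x - (1 / x) ^ 2 / 8 := by
  obtain ⟨d, rfl⟩ : ∃ d, y = x + d := ⟨y - x, by ring⟩
  have hd : 1 ≤ d := by linarith
  have hx0 : 0 < x := by linarith
  have hy0 : 0 < x + d := by linarith
  have hdiff : 1 / x - (1 / x) ^ 2 / 8 - (1 / (x + d) + (1 / (x + d)) ^ 2 / 8) =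
      (8 * d * x * (x + d) - x ^ 2 - (x + d) ^ 2) / (8 * x ^ 2 * (x + d) ^ 2) := by
    field_simp
    ring
  have hnum : 0 ≤ 8 * d * x * (x + d) - x ^ 2 - (x + d) ^ 2 := by
    have h1 : x ^ 2 ≤ d * x ^ 2 := le_mul_of_one_le_left (by positivity) hd
    have h2 : d * x ≤ d * x * d := le_mul_of_one_le_right (by positivity) hd
    have h3 : d ^ 2 ≤ d ^ 2 * x := le_mul_of_one_le_right (by positivity) hx
    nlinarith [mul_pos hx0 hx0, mul_pos (mul_pos hx0 hx0) (by linarith : 0 < d)]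
  rw [← sub_nonneg, hdiff]
  positivity

theorem disjoint_Iconf_of_godelNumber_lt {m : ℕ} {c c' : Config m}
    (h : godelNumber c < godelNumber c') : Disjoint (Iconf c) (Iconf c') := by
  have hle : phiEnc c' + phiEnc c' ^ 2 / 8 ≤ phiEnc c - phiEnc c ^ 2 / 8 := by
    rw [phiEnc_eq_one_div_godelNumber, phiEnc_eq_one_div_godelNumber]
    exact one_div_add_sq_le_one_div_sub_sq (by exact_mod_cast godelNumber_pos c)
      (by exact_mod_cast h)
  exact Set.disjoint_left.mpr fun x hx hx' => (hx.1.trans (hx'.2.trans_le hle)).false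

/-- For distinct configurations the open intervals `I_{(q,t)}`, centered at
`φ_enc(q,t)` of length `φ_enc(q,t)²/4`, are pairwise disjoint. -/
theorem statement7 (m : ℕ) (hm : 2 ≤ m) (c c' : Config m) (hcc : c ≠ c') :
    Disjoint (Iconf c) (Iconf c') := by
  rcases lt_or_gt_of_ne (godelNumber_injective.ne hcc) with h | h
  · exact disjoint_Iconf_of_godelNumber_lt h
  · exact (disjoint_Iconf_of_godelNumber_lt h).symm
end

section
/- For every Turing machine T there exist ε₀ > 0 and a C^∞ function f : ℝ² → ℝ such that for every i ∈ ℕ there is an integral curve γ : [0, ∞) → ℝ² of the gradient field ∇f with γ(0) = p_{cᵢ} satisfying: for every configuration (q, τ), there exists t ≥ 0 with γ(t) ∈ U_{(q,τ)} if and only if Δᵏ(cᵢ) = (q, τ) for some k ≥ 0. In particular, T halts on cᵢ if and only if γ intersects the open set ⋃_{τ ∈ 𝒜} U_{(q_halt, τ)}. -/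
/-- The open set `U_{(q,t)} = ⋃_{j,k ∈ ℕ} (2j + I_{(q,t)}) × (k − ε₀, k + ε₀) ⊂ ℝ²`. -/
def Uset {m : ℕ} (ε₀ : ℝ) (c : Config m) : Set (ℝ × ℝ) :=
  ⋃ (j : ℕ) (k : ℕ),
    (Set.Ioo (2 * (j : ℝ) + phiEnc c - phiEnc c ^ 2 / 8)
        (2 * (j : ℝ) + phiEnc c + phiEnc c ^ 2 / 8)) ×ˢ
      Set.Ioo ((k : ℝ) - ε₀) ((k : ℝ) + ε₀)

/-- The gradient `∇f = (∂₁ f, ∂₂ f)` of a function `f : ℝ² → ℝ`. -/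
noncomputable def grad2 (f : ℝ × ℝ → ℝ) (x : ℝ × ℝ) : ℝ × ℝ :=
  (fderiv ℝ f x (1, 0), fderiv ℝ f x (0, 1))

open Filter Topology

theorem fin_two_val_eq_ite (a : Fin 2) : (a : ℕ) = if a = 0 then 0 else 1 := by
  fin_cases a <;> rfl

theorem rEnc_eq_sum_two_pow (t : Tape) :
    rEnc t = ∑ n ∈ (t.support.filter (fun i => 0 ≤ i)).image Int.toNat, 2 ^ n := by
  rw [rEnc, Finset.sum_image]
  · refine Finset.sum_congr rfl fun i hi => ?_
    simp only [Finset.mem_filter, Finsupp.mem_support_iff] at hi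
    simp [fin_two_val_eq_ite, hi.1]
  · intro i hi j hj hij
    simp only [Finset.coe_filter, Set.mem_ofPred_eq] at hi hj
    omega

theorem sEnc_eq_sum_two_pow (t : Tape) :
    sEnc t =
      ∑ n ∈ (t.support.filter (fun i => i < 0)).image (fun i => (-i - 1).toNat), 2 ^ n := by
  rw [sEnc, Finset.sum_image]
  · refine Finset.sum_congr rfl fun i hi => ?_
    simp only [Finset.mem_filter, Finsupp.mem_support_iff] at hi
    simp [fin_two_val_eq_ite, hi.1]
  · intro i hi j hj hij
    simp only [Finset.coe_filter, Set.mem_ofPred_eq] at hi hj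
    dsimp only at hij
    omega

/-- A tape is determined by its two half-tape encodings. -/
theorem tape_ext_of_enc_eq {t u : Tape} (hr : rEnc t = rEnc u) (hs : sEnc t = sEnc u) :
    t = u := by
  rw [rEnc_eq_sum_two_pow, rEnc_eq_sum_two_pow] at hr
  rw [sEnc_eq_sum_two_pow, sEnc_eq_sum_two_pow] at hs
  replace hr := Finset.geomSum_injective le_rfl hr
  replace hs := Finset.geomSum_injective le_rfl hs
  have mem_iff (i : ℤ) : t i = 0 ↔ u i = 0 := by
    rcases le_or_gt 0 i with hi | hi
    · have key (v : Tape) :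
          v i ≠ 0 ↔ i.toNat ∈ (v.support.filter (fun i => 0 ≤ i)).image Int.toNat := by
        simp only [Finset.mem_image, Finset.mem_filter, Finsupp.mem_support_iff]
        refine ⟨fun h => ⟨i, ⟨h, hi⟩, rfl⟩, ?_⟩
        rintro ⟨j, ⟨hj, hj0⟩, hji⟩
        obtain rfl : j = i := by omega
        exact hj
      rw [← not_iff_not, ← ne_eq, ← ne_eq, key, key, hr]
    · have key (v : Tape) : v i ≠ 0 ↔ (-i - 1).toNat ∈
          (v.support.filter (fun i => i < 0)).image (fun i => (-i - 1).toNat) := by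
        simp only [Finset.mem_image, Finset.mem_filter, Finsupp.mem_support_iff]
        refine ⟨fun h => ⟨i, ⟨h, hi⟩, rfl⟩, ?_⟩
        rintro ⟨j, ⟨hj, hj0⟩, hji⟩
        obtain rfl : j = i := by omega
        exact hj
      rw [← not_iff_not, ← ne_eq, ← ne_eq, key, key, hs]
  ext i
  rw [fin_two_val_eq_ite, fin_two_val_eq_ite]
  simp [mem_iff]

/-- The natural number whose inverse is `phiEnc`. -/
noncomputable def natEnc {m : ℕ} (c : Config m) : ℕ :=
  2 ^ ((c.1 : ℕ) + 1) * 3 ^ rEnc c.2 * 5 ^ sEnc c.2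

theorem phiEnc_eq_inv_natEnc {m : ℕ} (c : Config m) : phiEnc c = (natEnc c : ℝ)⁻¹ := by
  simp [phiEnc, natEnc]

theorem two_le_natEnc {m : ℕ} (c : Config m) : 2 ≤ natEnc c := by
  have h2 : 1 ≤ 2 ^ (c.1 : ℕ) := Nat.one_le_two_pow
  have h3 : 1 ≤ 3 ^ rEnc c.2 := Nat.one_le_pow _ _ (by norm_num)
  have h5 : 1 ≤ 5 ^ sEnc c.2 := Nat.one_le_pow _ _ (by norm_num)
  calc 2 = 2 * 1 * 1 * 1 := by norm_num
    _ ≤ 2 ^ ((c.1 : ℕ) + 1) * 3 ^ rEnc c.2 * 5 ^ sEnc c.2 := by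
      rw [pow_succ']
      gcongr

theorem natEnc_injective {m : ℕ} : Function.Injective (natEnc (m := m)) := by
  intro c d h
  have fac (p a b e : ℕ) : (2 ^ a * 3 ^ b * 5 ^ e).factorization p =
      a * (Nat.factorization 2) p + b * (Nat.factorization 3) p
        + e * (Nat.factorization 5) p := by
    rw [Nat.factorization_mul (by positivity) (by positivity),
      Nat.factorization_mul (by positivity) (by positivity)]
    simp [Nat.factorization_pow]
  have hf (p : ℕ) := congrArg (fun n => n.factorization p) h
  simp only [natEnc, fac] at hf
  have p2 : Nat.Prime 2 := Nat.prime_two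
  have p3 : Nat.Prime 3 := Nat.prime_three
  have p5 : Nat.Prime 5 := Nat.prime_five
  have h2 := hf 2
  have h3 := hf 3
  have h5 := hf 5
  simp [p2.factorization, p3.factorization, p5.factorization] at h2 h3 h5
  exact Prod.ext (Fin.ext h2) (tape_ext_of_enc_eq h3 h5)

theorem phiEnc_mem_Ioc {m : ℕ} (c : Config m) : phiEnc c ∈ Set.Ioc (0 : ℝ) (1 / 2) := by
  have h : (2 : ℝ) ≤ natEnc c := by exact_mod_cast two_le_natEnc c
  rw [phiEnc_eq_inv_natEnc]
  refine ⟨by positivity, ?_⟩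
  rw [one_div]
  gcongr

/-- The encoding intervals separate configurations. -/
theorem eq_of_abs_phiEnc_sub_lt {m : ℕ} {c d : Config m}
    (h : |phiEnc d - phiEnc c| < phiEnc c ^ 2 / 8) : d = c := by
  by_contra hne
  have hN : natEnc d ≠ natEnc c := fun h => hne (natEnc_injective h)
  have hd : (2 : ℝ) ≤ natEnc d := by exact_mod_cast two_le_natEnc d
  have hc : (2 : ℝ) ≤ natEnc c := by exact_mod_cast two_le_natEnc c
  have hgap : (1 : ℝ) ≤ |(natEnc c : ℝ) - natEnc d| := by
    have : (1 : ℤ) ≤ |(natEnc c : ℤ) - natEnc d| :=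
      Int.one_le_abs (sub_ne_zero.mpr (by exact_mod_cast hN.symm))
    exact_mod_cast this
  rw [phiEnc_eq_inv_natEnc, phiEnc_eq_inv_natEnc,
    inv_sub_inv (by positivity) (by positivity), abs_div,
    abs_of_pos (by positivity : (0 : ℝ) < natEnc d * natEnc c), inv_pow, inv_eq_one_div, div_div,
    div_lt_div_iff₀ (by positivity) (by positivity)] at h
  have h8 : 8 * (natEnc c : ℝ) * |(natEnc c : ℝ) - natEnc d| < natEnc d := by
    refine lt_of_mul_lt_mul_right ?_ (by positivity : (0 : ℝ) ≤ natEnc c)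
    linarith
  have := neg_abs_le ((natEnc c : ℝ) - natEnc d)
  nlinarith

/-- If the `k`-th summand vanishes where `ψ ≤ k`, then the series is finite where `ψ < N`. -/
theorem tsum_eq_sum_range_of_vanishing {E : Type*} {ψ : E → ℝ} {u : ℕ → E → ℝ}
    (h0 : ∀ (k : ℕ) x, ψ x ≤ k → u k x = 0) {N : ℕ} {x : E} (hx : ψ x < N) :
    ∑' k, u k x = ∑ k ∈ Finset.range N, u k x := by
  refine tsum_eq_sum fun k hk => h0 k x (hx.le.trans ?_)
  simpa using hk

theorem contDiff_tsum_of_vanishing {E : Type*} [NormedAddCommGroup E] [NormedSpace ℝ E]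
    {n : WithTop ℕ∞} {ψ : E → ℝ} (hψ : Continuous ψ) {u : ℕ → E → ℝ}
    (hu : ∀ k, ContDiff ℝ n (u k)) (h0 : ∀ (k : ℕ) x, ψ x ≤ k → u k x = 0) :
    ContDiff ℝ n (fun x => ∑' k, u k x) := by
  rw [contDiff_iff_contDiffAt]
  intro x
  obtain ⟨N, hN⟩ := exists_nat_gt (ψ x)
  have hsum : ContDiffAt ℝ n (fun x => ∑ k ∈ Finset.range N, u k x) x :=
    (ContDiff.sum fun k _ => hu k).contDiffAt
  refine hsum.congr_of_eventuallyEq ?_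
  filter_upwards [hψ.continuousAt.eventually_lt_const hN] with y hy
  exact tsum_eq_sum_range_of_vanishing h0 hy

/-- Smooth interpolation of a sequence, constant near every natural number. -/
theorem exists_contDiff_interpolation (a : ℕ → ℝ) :
    ∃ h : ℝ → ℝ, ContDiff ℝ (⊤ : ℕ∞) h ∧
      (∀ n : ℕ, ∀ y : ℝ, |y - n| < 1 / 4 → h y = a n) ∧
      ∀ y : ℝ, 0 ≤ y → ∃ n : ℕ, h y ∈ Set.uIcc (a n) (a (n + 1)) := by
  let s : ℕ → ℝ → ℝ := fun k y => Real.smoothTransition (2 * (y - k) - 1 / 2)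
  have hs (k : ℕ) : ContDiff ℝ (⊤ : ℕ∞) (s k) :=
    Real.smoothTransition.contDiff.comp (by fun_prop)
  have s_zero {k : ℕ} {y : ℝ} (hy : y ≤ k + 1 / 4) : s k y = 0 :=
    Real.smoothTransition.zero_of_nonpos (by linarith)
  have s_one {k : ℕ} {y : ℝ} (hy : k + 3 / 4 ≤ y) : s k y = 1 :=
    Real.smoothTransition.one_of_one_le (by linarith)
  have h0 : ∀ (k : ℕ) y, id y ≤ (k : ℝ) → (a (k + 1) - a k) * s k y = 0 := by
    intro k y hy
    rw [id] at hy
    rw [s_zero (by linarith), mul_zero]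
  have hval {n : ℕ} {y : ℝ} (hl : n - 1 / 4 ≤ y) (hu : y < n + 1) :
      a 0 + ∑' k, (a (k + 1) - a k) * s k y = a n + (a (n + 1) - a n) * s n y := by
    rw [tsum_eq_sum_range_of_vanishing (ψ := id) h0 (N := n + 1) (by push_cast; exact hu),
      Finset.sum_range_succ]
    have : ∑ k ∈ Finset.range n, (a (k + 1) - a k) * s k y = a n - a 0 := by
      rw [← Finset.sum_range_sub]
      refine Finset.sum_congr rfl fun k hk => ?_
      have hk' : (k : ℝ) + 1 ≤ n := by exact_mod_cast Finset.mem_range.mp hk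
      rw [s_one (by linarith), mul_one]
    rw [this]
    ring
  refine ⟨fun y => a 0 + ∑' k, (a (k + 1) - a k) * s k y, ?_, ?_, ?_⟩
  · exact contDiff_const.add
      (contDiff_tsum_of_vanishing continuous_id (fun k => contDiff_const.mul (hs k)) h0)
  · intro n y hy
    rw [abs_lt] at hy
    dsimp only
    rw [hval (n := n) (by linarith) (by linarith), s_zero (by linarith), mul_zero, add_zero]
  · intro y hy
    refine ⟨⌊y⌋₊, ?_⟩
    dsimp only
    rw [hval (by linarith [Nat.floor_le hy]) (Nat.lt_floor_add_one y)]
    have hmem : s ⌊y⌋₊ y ∈ Set.Icc (0 : ℝ) 1 :=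
      ⟨Real.smoothTransition.nonneg _, Real.smoothTransition.le_one _⟩
    rw [← segment_eq_uIcc, segment_eq_image']
    exact ⟨_, hmem, by simp [mul_comm]⟩

/-- The graph `x = h y` of a smooth function, parametrized by `y`, is an integral curve of the
gradient of some smooth function. -/
theorem exists_contDiff_grad2_eq {h : ℝ → ℝ} (hh : ContDiff ℝ (⊤ : ℕ∞) h) :
    ∃ g : ℝ × ℝ → ℝ, ContDiff ℝ (⊤ : ℕ∞) g ∧ ∀ y, grad2 g (h y, y) = (deriv h y, 1) := by
  have hd : ContDiff ℝ (⊤ : ℕ∞) (deriv h) := (contDiff_infty_iff_deriv.mp hh).2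
  have hv : ContDiff ℝ (⊤ : ℕ∞) (fun y => 1 + deriv h y ^ 2) := by fun_prop
  let F : ℝ → ℝ := fun y => ∫ t in (0 : ℝ)..y, (1 + deriv h t ^ 2)
  have hF (y : ℝ) : HasDerivAt F (1 + deriv h y ^ 2) y :=
    (hv.continuous.integral_hasStrictDerivAt 0 y).hasDerivAt
  have hFc : ContDiff ℝ (⊤ : ℕ∞) F := by
    refine contDiff_infty_iff_deriv.mpr ⟨fun y => (hF y).differentiableAt, ?_⟩
    rwa [funext fun y => (hF y).deriv]
  refine ⟨fun p => F p.2 + deriv h p.2 * (p.1 - h p.2), by fun_prop, fun y => ?_⟩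
  have hhy : HasDerivAt h (deriv h y) y :=
    ((contDiff_infty_iff_deriv.mp hh).1 y).hasDerivAt
  have hdy : HasDerivAt (deriv h) (deriv (deriv h) y) y :=
    ((contDiff_infty_iff_deriv.mp hd).1 y).hasDerivAt
  have hsnd : HasFDerivAt (fun p : ℝ × ℝ => p.2) (ContinuousLinearMap.snd ℝ ℝ ℝ) (h y, y) :=
    hasFDerivAt_snd
  have hfst : HasFDerivAt (fun p : ℝ × ℝ => p.1) (ContinuousLinearMap.fst ℝ ℝ ℝ) (h y, y) :=
    hasFDerivAt_fst
  have hg := ((hF y).comp_hasFDerivAt (h y, y) hsnd).add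
    ((hdy.comp_hasFDerivAt (h y, y) hsnd).mul
      (hfst.sub (hhy.comp_hasFDerivAt (h y, y) hsnd)))
  have hg' : fderiv ℝ (fun p : ℝ × ℝ => F p.2 + deriv h p.2 * (p.1 - h p.2)) (h y, y) = _ :=
    hg.fderiv
  rw [grad2, hg']
  simp
  ring

/-- Countably many smooth functions can be glued along the disjoint strips
`2 i ≤ x ≤ 2 i + 1`. -/
theorem exists_contDiff_strip_gluing {g : ℕ → ℝ × ℝ → ℝ}
    (hg : ∀ i, ContDiff ℝ (⊤ : ℕ∞) (g i)) :
    ∃ f : ℝ × ℝ → ℝ, ContDiff ℝ (⊤ : ℕ∞) f ∧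
      ∀ (i : ℕ) (p : ℝ × ℝ), p.1 ∈ Set.Icc (2 * (i : ℝ)) (2 * i + 1) → f =ᶠ[𝓝 p] g i := by
  let χ : ℝ → ℝ := fun x =>
    Real.smoothTransition (4 * x + 2) * Real.smoothTransition (7 / 2 - 2 * x)
  have hχ : ContDiff ℝ (⊤ : ℕ∞) χ :=
    (Real.smoothTransition.contDiff.comp (by fun_prop)).mul
      (Real.smoothTransition.contDiff.comp (by fun_prop))
  let u : ℕ → ℝ × ℝ → ℝ := fun i p => χ (p.1 - 2 * i) * g i p
  have hu (i : ℕ) : ContDiff ℝ (⊤ : ℕ∞) (u i) :=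
    (hχ.comp (contDiff_fst.sub contDiff_const)).mul (hg i)
  let ψ : ℝ × ℝ → ℝ := fun p => (p.1 + 1 / 2) / 2
  have hψ : Continuous ψ := by fun_prop
  have h0 : ∀ (i : ℕ) p, ψ p ≤ i → u i p = 0 := by
    intro i p hp
    simp only [ψ] at hp
    simp only [u, χ]
    rw [Real.smoothTransition.zero_of_nonpos (by linarith), zero_mul, zero_mul]
  refine ⟨fun p => ∑' i, u i p, contDiff_tsum_of_vanishing hψ hu h0, ?_⟩
  rintro i p ⟨hp1, hp2⟩
  filter_upwards [continuousAt_fst.eventually_const_lt (by linarith : 2 * (i : ℝ) - 1 / 4 < p.1),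
    continuousAt_fst.eventually_lt_const (by linarith : p.1 < 2 * (i : ℝ) + 5 / 4)] with q hq1 hq2
  rw [tsum_eq_sum_range_of_vanishing h0 (N := i + 1) (by simp only [ψ]; push_cast; linarith),
    Finset.sum_range_succ, Finset.sum_eq_zero, zero_add]
  · simp only [u, χ]
    rw [Real.smoothTransition.one_of_one_le (by linarith),
      Real.smoothTransition.one_of_one_le (by linarith), one_mul, one_mul]
  · intro j hj
    have hj' : (j : ℝ) + 1 ≤ i := by exact_mod_cast Finset.mem_range.mp hj
    simp only [u, χ]
    rw [Real.smoothTransition.zero_of_nonpos (x := 7 / 2 - 2 * (q.1 - 2 * j)) (by linarith),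
      mul_zero, zero_mul]

theorem mem_Uset_of_phiEnc {m : ℕ} {ε₀ : ℝ} (hε : 0 < ε₀) (c : Config m) (i k : ℕ) :
    (2 * (i : ℝ) + phiEnc c, (k : ℝ)) ∈ Uset ε₀ c := by
  have hφ := (phiEnc_mem_Ioc c).1
  have : 0 < phiEnc c ^ 2 / 8 := by positivity
  simp only [Uset, Set.mem_iUnion]
  refine ⟨i, k, ⟨?_, ?_⟩, ?_, ?_⟩ <;> dsimp only <;> linarith

theorem eq_of_mem_Ioo_phiEnc {m : ℕ} {c d : Config m} {i j : ℕ}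
    (h : 2 * (i : ℝ) + phiEnc d ∈ Set.Ioo (2 * (j : ℝ) + phiEnc c - phiEnc c ^ 2 / 8)
      (2 * (j : ℝ) + phiEnc c + phiEnc c ^ 2 / 8)) : d = c := by
  obtain ⟨hd0, hd1⟩ := phiEnc_mem_Ioc d
  obtain ⟨hc0, hc1⟩ := phiEnc_mem_Ioc c
  obtain ⟨h1, h2⟩ := h
  have hij : i = j := by
    have h3 : (i : ℝ) < j + 1 := by nlinarith
    have h4 : (j : ℝ) < i + 1 := by nlinarith
    norm_cast at h3 h4
    omega
  subst hij
  refine eq_of_abs_phiEnc_sub_lt ?_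
  rw [abs_lt]
  constructor <;> linarith

/-- There is a smooth function `f : ℝ² → ℝ` whose gradient flow simulates the Turing
machine `T`: the integral curve through `p_{cᵢ}` visits `U_{(q,τ)}` if and only if the
configuration `(q,τ)` is reached by the machine starting from `cᵢ = (q₀, tⁱ)`. In
particular `T` halts on `cᵢ` iff the curve meets `⋃_τ U_{(q_halt,τ)}`. -/
theorem statement8 (m : ℕ) (hm : 2 ≤ m) (T : TuringMachine m) (tape : ℕ ≃ Tape) :
    ∃ (ε₀ : ℝ) (f : ℝ × ℝ → ℝ), 0 < ε₀ ∧ ContDiff ℝ (⊤ : ℕ∞) f ∧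
      ∀ i : ℕ, ∃ γ : ℝ → ℝ × ℝ,
        γ 0 = (2 * (i : ℝ) + phiEnc ((T.q0, tape i) : Config m), 0) ∧
        (∀ t : ℝ, 0 ≤ t → HasDerivAt γ (grad2 f (γ t)) t) ∧
        (∀ c : Config m,
          (∃ t : ℝ, 0 ≤ t ∧ γ t ∈ Uset ε₀ c) ↔
            ∃ k : ℕ, T.step^[k] (T.q0, tape i) = c) ∧
        ((∃ k : ℕ, (T.step^[k] (T.q0, tape i)).1 = T.qhalt) ↔
          ∃ t : ℝ, 0 ≤ t ∧ γ t ∈ ⋃ τ : Tape, Uset ε₀ ((T.qhalt, τ) : Config m)) := by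
  let c : ℕ → ℕ → Config m := fun i k => T.step^[k] (T.q0, tape i)
  choose h hsmooth hnear hrange using
    fun i : ℕ => exists_contDiff_interpolation fun k => 2 * (i : ℝ) + phiEnc (c i k)
  choose g hg hgrad using fun i => exists_contDiff_grad2_eq (hsmooth i)
  obtain ⟨f, hf, hfg⟩ := exists_contDiff_strip_gluing hg
  refine ⟨1 / 4, f, by norm_num, hf, fun i => ?_⟩
  have hstrip (y : ℝ) (hy : 0 ≤ y) : h i y ∈ Set.Icc (2 * (i : ℝ)) (2 * i + 1) := by
    obtain ⟨n, hn⟩ := hrange i y hy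
    refine Set.uIcc_subset_Icc ?_ ?_ hn <;>
    · obtain ⟨h0, h1⟩ := phiEnc_mem_Ioc (c i n)
      obtain ⟨h0', h1'⟩ := phiEnc_mem_Ioc (c i (n + 1))
      constructor <;> linarith
  have hvisit (d : Config m) : (∃ t : ℝ, 0 ≤ t ∧ (h i t, t) ∈ Uset (1 / 4) d) ↔
      ∃ k : ℕ, T.step^[k] (T.q0, tape i) = d := by
    constructor
    · rintro ⟨t, -, ht⟩
      simp only [Uset, Set.mem_iUnion] at ht
      obtain ⟨j, k, hx, hy⟩ := ht
      refine ⟨k, eq_of_mem_Ioo_phiEnc (i := i) (j := j) ?_⟩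
      obtain ⟨hy1, hy2⟩ := hy
      dsimp only at hx hy1 hy2
      rwa [hnear i k t (by rw [abs_lt]; constructor <;> linarith)] at hx
    · rintro ⟨k, rfl⟩
      refine ⟨k, k.cast_nonneg, ?_⟩
      rw [hnear i k k (by norm_num)]
      exact mem_Uset_of_phiEnc (by norm_num) _ _ _
  refine ⟨fun t => (h i t, t), ?_, fun t ht => ?_, hvisit, ?_⟩
  · exact Prod.ext (hnear i 0 0 (by norm_num)) rfl
  · have hgr : grad2 f (h i t, t) = (deriv (h i) t, 1) := by
      rw [← hgrad i t, grad2, grad2, (hfg i (h i t, t) (hstrip t ht)).fderiv_eq]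
    rw [hgr]
    exact ((contDiff_infty_iff_deriv.mp (hsmooth i)).1 t).hasDerivAt.prodMk (hasDerivAt_id t)
  · constructor
    · rintro ⟨k, hk⟩
      obtain ⟨t, ht, hmem⟩ := (hvisit _).mpr ⟨k, rfl⟩
      refine ⟨t, ht, Set.mem_iUnion.mpr ⟨(T.step^[k] (T.q0, tape i)).2, ?_⟩⟩
      rwa [← hk]
    · rintro ⟨t, ht, hmem⟩
      obtain ⟨τ, hτ⟩ := Set.mem_iUnion.mp hmem
      obtain ⟨k, hk⟩ := (hvisit _).mp ⟨t, ht, hτ⟩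
      exact ⟨k, by rw [hk]⟩
end

section
/- For every Turing machine T there exist ε₀ > 0, a C^∞ function f : ℝ² → ℝ, and a continuous function η : ℝ² → (0, ∞) such that for every locally Lipschitz vector field Y on ℝ² satisfying |Y(x) − ∇f(x)| ≤ η(x) for all x ∈ ℝ², and for every i ∈ ℕ, there is an integral curve γ : [0, ∞) → ℝ² of Y with γ(0) = p_{cᵢ} satisfying: for every configuration (q, τ), there exists t ≥ 0 with γ(t) ∈ U_{(q,τ)} if and only if Δᵏ(cᵢ) = (q, τ) for some k ≥ 0. That is, the simulation of T by the gradient flow of f is robust under perturbations that decay sufficiently fast at infinity. -/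
/-- The Euclidean norm on `ℝ²`. -/
noncomputable def enorm2 (v : ℝ × ℝ) : ℝ := Real.sqrt (v.1 ^ 2 + v.2 ^ 2)


namespace TuringFlow

open Set Filter Topology

/-! ### Injectivity of the encoding -/

theorem sum_two_pow_support_filter (t : Tape) (p : ℤ → Prop) [DecidablePred p] (e : ℤ → ℕ)
    (he : Set.InjOn e {i | p i}) :
    ∑ i ∈ t.support.filter p, ((t i : ℕ) * 2 ^ e i) =
      ∑ n ∈ (t.support.filter p).image e, 2 ^ n := by
  have hinj : Set.InjOn e (t.support.filter p : Finset ℤ) := fun i hi j hj h =>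
    he (Finset.mem_filter.1 hi).2 (Finset.mem_filter.1 hj).2 h
  rw [Finset.sum_image hinj]
  refine Finset.sum_congr rfl fun i hi => ?_
  have h := Finsupp.mem_support_iff.1 (Finset.mem_filter.1 hi).1
  have h1 : ((t i : Fin 2) : ℕ) = 1 := by omega
  rw [h1, one_mul]

theorem mem_support_iff_of_sum_eq {t t' : Tape} (p : ℤ → Prop) [DecidablePred p] (e : ℤ → ℕ)
    (he : Set.InjOn e {i | p i})
    (h : ∑ i ∈ t.support.filter p, ((t i : ℕ) * 2 ^ e i) =
      ∑ i ∈ t'.support.filter p, ((t' i : ℕ) * 2 ^ e i)) (i : ℤ) (hi : p i) :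
    i ∈ t.support ↔ i ∈ t'.support := by
  rw [sum_two_pow_support_filter t p e he, sum_two_pow_support_filter t' p e he] at h
  have him : (t.support.filter p).image e = (t'.support.filter p).image e :=
    Finset.geomSum_injective le_rfl h
  have aux : ∀ s : Tape, i ∈ s.support ↔ e i ∈ (s.support.filter p).image e := fun s => by
    simp only [Finset.mem_image, Finset.mem_filter]
    refine ⟨fun hs => ⟨i, ⟨hs, hi⟩, rfl⟩, ?_⟩
    rintro ⟨j, ⟨hj, hpj⟩, hji⟩
    exact he hpj hi hji ▸ hj
  rw [aux, aux, him]

theorem tape_eq_of_enc_eq {t t' : Tape} (hr : rEnc t = rEnc t') (hs : sEnc t = sEnc t') :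
    t = t' := by
  have hmem : ∀ i, i ∈ t.support ↔ i ∈ t'.support := fun i => by
    rcases le_or_gt 0 i with hi | hi
    · refine mem_support_iff_of_sum_eq (fun i => 0 ≤ i) Int.toNat ?_ hr i hi
      intro a ha b hb hab
      simp only [mem_ofPred_eq] at ha hb
      omega
    · refine mem_support_iff_of_sum_eq (fun i => i < 0) (fun i => (-i - 1).toNat) ?_ hs i hi
      intro a ha b hb hab
      simp only [mem_ofPred_eq] at ha hb hab
      omega
  ext i
  have := hmem i
  simp only [Finsupp.mem_support_iff] at this
  omega

/-- The denominator of `phiEnc`. -/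
noncomputable def encNat {m : ℕ} (c : Config m) : ℕ :=
  2 ^ ((c.1 : ℕ) + 1) * 3 ^ rEnc c.2 * 5 ^ sEnc c.2

theorem encNat_injective {m : ℕ} : Function.Injective (encNat (m := m)) := by
  have key : ∀ c : Config m, (encNat c).factorization 2 = (c.1 : ℕ) + 1 ∧
      (encNat c).factorization 3 = rEnc c.2 ∧ (encNat c).factorization 5 = sEnc c.2 := fun c => by
    have h2 : Nat.Prime 2 := Nat.prime_two
    have h3 : Nat.Prime 3 := Nat.prime_three
    have h5 : Nat.Prime 5 := Nat.prime_five
    unfold encNat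
    rw [Nat.factorization_mul (by positivity) (by positivity),
      Nat.factorization_mul (by positivity) (by positivity), h2.factorization_pow,
      h3.factorization_pow, h5.factorization_pow]
    simp
  intro c c' h
  obtain ⟨h1, h2, h3⟩ := key c
  obtain ⟨h1', h2', h3'⟩ := key c'
  rw [h] at h1 h2 h3
  refine Prod.ext (Fin.ext ?_) (tape_eq_of_enc_eq (h2.symm.trans h2') (h3.symm.trans h3'))
  omega

theorem phiEnc_eq {m : ℕ} (c : Config m) : phiEnc c = 1 / (encNat c : ℝ) := by
  simp [phiEnc, encNat]

theorem two_le_encNat {m : ℕ} (c : Config m) : 2 ≤ encNat c := by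
  unfold encNat
  have h1 : 1 ≤ 2 ^ (c.1 : ℕ) := Nat.one_le_two_pow
  have h2 : 1 ≤ 3 ^ rEnc c.2 := Nat.one_le_pow _ _ (by norm_num)
  have h3 : 1 ≤ 5 ^ sEnc c.2 := Nat.one_le_pow _ _ (by norm_num)
  calc 2 = 2 * 1 * 1 * 1 := by norm_num
    _ ≤ 2 * 2 ^ (c.1 : ℕ) * 3 ^ rEnc c.2 * 5 ^ sEnc c.2 := by gcongr
    _ = _ := by rw [pow_succ]; ring

theorem phiEnc_pos {m : ℕ} (c : Config m) : 0 < phiEnc c := by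
  unfold phiEnc; positivity

theorem phiEnc_le_half {m : ℕ} (c : Config m) : phiEnc c ≤ 1 / 2 := by
  rw [phiEnc_eq]
  have : (2 : ℝ) ≤ encNat c := by exact_mod_cast two_le_encNat c
  gcongr

theorem inv_sq_add_inv_sq_le {a b : ℕ} (ha : 0 < a) (hab : a < b) :
    (1 / (a : ℝ)) ^ 2 / 8 + (1 / (b : ℝ)) ^ 2 / 8 ≤ 1 / a - 1 / b := by
  have ha' : (1 : ℝ) ≤ a := by exact_mod_cast ha
  have hb : (a : ℝ) + 1 ≤ b := by exact_mod_cast hab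
  have h1 : 1 / (b : ℝ) ≤ 1 / (a + 1) := by gcongr
  have h2 : (1 / (b : ℝ)) ≤ 1 / a := by gcongr
  have h3 : (1 / (b : ℝ)) ^ 2 ≤ (1 / a) ^ 2 := by gcongr
  have h4 : (1 / (a : ℝ)) ^ 2 / 4 ≤ 1 / a - 1 / (a + 1) := by
    rw [div_sub_div _ _ (by positivity) (by positivity), div_pow, div_div,
      div_le_div_iff₀ (by positivity) (by positivity)]
    nlinarith
  linarith

theorem eq_of_abs_phiEnc_sub_lt {m : ℕ} {c c' : Config m}
    (h : |phiEnc c - phiEnc c'| < phiEnc c ^ 2 / 8 + phiEnc c' ^ 2 / 8) : c = c' := by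
  by_contra hne
  rw [phiEnc_eq, phiEnc_eq, abs_lt] at h
  have hc := two_le_encNat c
  have hc' := two_le_encNat c'
  rcases lt_or_gt_of_ne (encNat_injective.ne hne) with hlt | hlt
  · have := inv_sq_add_inv_sq_le (by omega) hlt
    linarith
  · have := inv_sq_add_inv_sq_le (by omega) hlt
    linarith

end TuringFlow

namespace TuringFlow

open Set Filter Topology
open scoped ContDiff

/-! ### Smooth interpolation -/

/-- A smooth monotone step from `0` to `1`, constant outside `[1/4, 3/4]`, of slope at most
`8/3`. -/
structure IsSmoothStep (H : ℝ → ℝ) : Prop where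
  contDiff : ContDiff ℝ ∞ H
  monotone : Monotone H
  eq_zero : ∀ t ≤ 1 / 4, H t = 0
  eq_one : ∀ t, 3 / 4 ≤ t → H t = 1
  abs_deriv_le : ∀ t, |deriv H t| ≤ 8 / 3

theorem contDiff_integral {ψ : ℝ → ℝ} (h : ContDiff ℝ ∞ ψ) (a : ℝ) :
    ContDiff ℝ ∞ fun t => ∫ s in a..t, ψ s := by
  have hd : ∀ t, HasDerivAt (fun t => ∫ s in a..t, ψ s) (ψ t) t := fun t =>
    intervalIntegral.integral_hasDerivAt_right (h.continuous.intervalIntegrable _ _)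
      (h.continuous.stronglyMeasurableAtFilter _ _) h.continuous.continuousAt
  rw [contDiff_infty_iff_deriv]
  refine ⟨fun t => (hd t).differentiableAt, ?_⟩
  rwa [funext fun t => (hd t).deriv]

theorem exists_isSmoothStep : ∃ H, IsSmoothStep H := by
  let ψ : ContDiffBump (1 / 2 : ℝ) := ⟨3 / 16, 1 / 4, by norm_num, by norm_num⟩
  have hψ : ContDiff ℝ ∞ ψ := ψ.contDiff
  have hint : ∀ a b, IntervalIntegrable ψ MeasureTheory.volume a b := fun a b =>
    hψ.continuous.intervalIntegrable a b
  have hzero : ∀ t, (t ≤ 1 / 4 ∨ 3 / 4 ≤ t) → ψ t = 0 := fun t ht => by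
    refine ψ.zero_of_le_dist ?_
    change 1 / 4 ≤ dist t (1 / 2)
    rw [Real.dist_eq, le_abs]
    rcases ht with ht | ht
    · right; linarith
    · left; linarith
  set I : ℝ → ℝ := fun t => ∫ s in (1 / 4 : ℝ)..t, ψ s with hI
  have hd : ∀ t, HasDerivAt I (ψ t) t := fun t =>
    intervalIntegral.integral_hasDerivAt_right (hint _ _)
      (hψ.continuous.stronglyMeasurableAtFilter _ _) hψ.continuous.continuousAt
  have hmono : Monotone I := monotone_of_deriv_nonneg (fun t => (hd t).differentiableAt)
    fun t => by rw [(hd t).deriv]; exact ψ.nonneg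
  have hconst : ∀ t, 3 / 4 ≤ t → I t = I (3 / 4) := fun t ht => by
    have h := intervalIntegral.integral_add_adjacent_intervals (hint (1 / 4) (3 / 4))
      (hint (3 / 4) t)
    have h0 : ∫ s in (3 / 4 : ℝ)..t, ψ s = 0 := by
      rw [intervalIntegral.integral_congr (g := fun _ => (0 : ℝ))]
      · simp
      · intro s hs
        rw [uIcc_of_le ht] at hs
        exact hzero s (Or.inr hs.1)
    simp only [hI]
    rw [← h, h0, add_zero]
  have hbelow : ∀ t ≤ 1 / 4, I t = 0 := fun t ht => by
    simp only [hI]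
    rw [intervalIntegral.integral_congr (g := fun _ => (0 : ℝ))]
    · simp
    · intro s hs
      rw [uIcc_of_ge ht] at hs
      exact hzero s (Or.inl hs.2)
  have hmass : 3 / 8 ≤ I (3 / 4) := by
    have h1 : I (11 / 16) - I (5 / 16) = 3 / 8 := by
      have h := intervalIntegral.integral_interval_sub_left (hint (1 / 4) (11 / 16))
        (hint (1 / 4) (5 / 16))
      simp only [hI]
      rw [h, intervalIntegral.integral_congr (g := fun _ => (1 : ℝ))]
      · simp; norm_num
      · intro s hs
        rw [uIcc_of_le (by norm_num)] at hs
        refine ψ.one_of_mem_closedBall ?_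
        change dist s (1 / 2) ≤ 3 / 16
        rw [Real.dist_eq, abs_le]
        constructor <;> linarith [hs.1, hs.2]
    have h2 : I (11 / 16) ≤ I (3 / 4) := hmono (by norm_num)
    have h3 : 0 ≤ I (5 / 16) := by
      rw [← hbelow (1 / 4) le_rfl]
      exact hmono (by norm_num)
    linarith
  have hpos : 0 < I (3 / 4) := by linarith
  refine ⟨fun t => I t / I (3 / 4), (contDiff_integral hψ _).div_const _,
    fun a b hab => ?_, fun t ht => ?_, fun t ht => ?_, fun t => ?_⟩
  · exact div_le_div_of_nonneg_right (hmono hab) hpos.le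
  · simp only [hbelow t ht, zero_div]
  · simp only [hconst t ht]
    exact div_self hpos.ne'
  · rw [((hd t).div_const _).deriv, abs_of_nonneg (div_nonneg ψ.nonneg hpos.le),
      div_le_iff₀ hpos]
    have := ψ.le_one (x := t)
    linarith

theorem IsSmoothStep.nonneg {H : ℝ → ℝ} (h : IsSmoothStep H) (t : ℝ) : 0 ≤ H t := by
  rw [← h.eq_zero (min t (1 / 4)) (min_le_right _ _)]
  exact h.monotone (min_le_left _ _)

theorem IsSmoothStep.le_one {H : ℝ → ℝ} (h : IsSmoothStep H) (t : ℝ) : H t ≤ 1 := by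
  rw [← h.eq_one (max t (3 / 4)) (le_max_right _ _)]
  exact h.monotone (le_max_left _ _)

theorem IsSmoothStep.deriv_eq_zero {H : ℝ → ℝ} (h : IsSmoothStep H) {t : ℝ}
    (ht : t ≤ 0 ∨ 1 ≤ t) : deriv H t = 0 := by
  rcases ht with ht | ht
  · have : H =ᶠ[𝓝 t] fun _ => 0 := by
      filter_upwards [Iio_mem_nhds (show t < 1 / 4 by linarith)] with s hs
      exact h.eq_zero s (le_of_lt hs)
    rw [this.deriv_eq, deriv_const]
  · have : H =ᶠ[𝓝 t] fun _ => 1 := by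
      filter_upwards [Ioi_mem_nhds (show 3 / 4 < t by linarith)] with s hs
      exact h.eq_one s (le_of_lt hs)
    rw [this.deriv_eq, deriv_const]

/-- Partial sums of the interpolation of the sequence `a`. -/
noncomputable def interpSum (H : ℝ → ℝ) (a : ℕ → ℝ) (N : ℕ) (t : ℝ) : ℝ :=
  a 0 + ∑ k ∈ Finset.range N, (a (k + 1) - a k) * H (t - k)

/-- A function interpolating the values `a k` at `k : ℕ`, with steps shaped by `H`. -/
noncomputable def interp (H : ℝ → ℝ) (a : ℕ → ℝ) (t : ℝ) : ℝ :=
  interpSum H a ⌈t⌉₊ t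

variable {H : ℝ → ℝ}

theorem interp_eq_interpSum (h : IsSmoothStep H) (a : ℕ → ℝ) {N : ℕ} {t : ℝ} (hN : t ≤ N) :
    interp H a t = interpSum H a N t := by
  unfold interp interpSum
  congr 1
  refine Finset.sum_subset (Finset.range_mono (Nat.ceil_le.2 hN)) fun k _ hk => ?_
  have hk' : t ≤ k := Nat.ceil_le.1 (by simpa using hk)
  rw [h.eq_zero _ (by linarith), mul_zero]

theorem interp_contDiff {E : Type*} [NormedAddCommGroup E] [NormedSpace ℝ E]
    (h : IsSmoothStep H) {a : ℕ → E → ℝ} {s : E → ℝ} (ha : ∀ k, ContDiff ℝ ∞ (a k))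
    (hs : ContDiff ℝ ∞ s) : ContDiff ℝ ∞ fun z => interp H (fun k => a k z) (s z) := by
  rw [contDiff_iff_contDiffAt]
  intro z
  obtain ⟨N, hN⟩ := exists_nat_gt (s z)
  have heq : (fun z => interp H (fun k => a k z) (s z)) =ᶠ[𝓝 z]
      fun z => interpSum H (fun k => a k z) N (s z) := by
    filter_upwards [hs.continuous.continuousAt.eventually (Iio_mem_nhds hN)] with w hw
    exact interp_eq_interpSum h _ (le_of_lt hw)
  refine ContDiffAt.congr_of_eventuallyEq (ContDiff.contDiffAt ?_) heq
  unfold interpSum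
  refine (ha 0).add (ContDiff.sum fun k _ => ((ha (k + 1)).sub (ha k)).mul ?_)
  exact h.contDiff.comp (hs.sub contDiff_const)

theorem interp_of_nonpos (h : IsSmoothStep H) (a : ℕ → ℝ) {t : ℝ} (ht : t ≤ 0) :
    interp H a t = a 0 := by
  rw [interp_eq_interpSum h a (N := 0) (by simpa using ht)]
  simp [interpSum]

theorem interp_of_mem_Icc (h : IsSmoothStep H) (a : ℕ → ℝ) {k : ℕ} {t : ℝ} (h0 : (k : ℝ) ≤ t)
    (h1 : t ≤ k + 1) : interp H a t = a k + (a (k + 1) - a k) * H (t - k) := by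
  rw [interp_eq_interpSum h a (N := k + 1) (by push_cast; exact h1), interpSum,
    Finset.sum_range_succ, ← add_assoc]
  congr 1
  have : ∀ j ∈ Finset.range k, (a (j + 1) - a j) * H (t - j) = a (j + 1) - a j := fun j hj => by
    have hj' : (j : ℝ) + 1 ≤ k := by exact_mod_cast Finset.mem_range.1 hj
    rw [h.eq_one _ (by linarith), mul_one]
  rw [Finset.sum_congr rfl this, Finset.sum_range_sub, add_sub_cancel]

theorem interp_exists_convex (h : IsSmoothStep H) (a : ℕ → ℝ) (t : ℝ) :
    ∃ k θ, 0 ≤ θ ∧ θ ≤ 1 ∧ interp H a t = a k + (a (k + 1) - a k) * θ := by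
  rcases le_or_gt t 0 with ht | ht
  · exact ⟨0, 0, le_rfl, zero_le_one, by rw [interp_of_nonpos h a ht]; ring⟩
  · exact ⟨⌊t⌋₊, H (t - ⌊t⌋₊), h.nonneg _, h.le_one _,
      interp_of_mem_Icc h a (Nat.floor_le ht.le) (Nat.lt_floor_add_one t).le⟩

theorem interp_of_near_nat (h : IsSmoothStep H) (a : ℕ → ℝ) {k : ℕ} {t : ℝ}
    (ht : |t - k| ≤ 1 / 4) : interp H a t = a k := by
  rw [abs_le] at ht
  rcases le_or_gt (k : ℝ) t with hk | hk
  · rw [interp_of_mem_Icc h a hk (by linarith), h.eq_zero _ ht.2, mul_zero, add_zero]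
  · rcases k with _ | j
    · exact interp_of_nonpos h a (by simpa using hk.le)
    · push_cast at ht hk
      rw [interp_of_mem_Icc h a (k := j) (by linarith) (by linarith), h.eq_one _ (by linarith)]
      ring

theorem interp_antitone (h : IsSmoothStep H) {a : ℕ → ℝ} (ha : Antitone a) :
    Antitone (interp H a) := by
  intro s t hst
  rw [interp_eq_interpSum h a (Nat.le_ceil t), interp_eq_interpSum h a (hst.trans (Nat.le_ceil t))]
  unfold interpSum
  refine add_le_add le_rfl (Finset.sum_le_sum fun k _ => ?_)
  refine mul_le_mul_of_nonpos_left (h.monotone (by linarith)) ?_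
  linarith [ha (Nat.le_succ k)]

theorem interp_pos (h : IsSmoothStep H) {a : ℕ → ℝ} (ha : Antitone a) (ha0 : ∀ n, 0 < a n)
    (t : ℝ) : 0 < interp H a t := by
  obtain ⟨N, hN⟩ := exists_nat_ge t
  refine (ha0 N).trans_le ?_
  rw [← interp_of_near_nat h a (k := N) (t := N) (by simp)]
  exact interp_antitone h ha hN

theorem interp_le (h : IsSmoothStep H) {a : ℕ → ℝ} (ha : Antitone a) {b : ℝ} (hb : ∀ n, a n ≤ b)
    (t : ℝ) : interp H a t ≤ b := by
  refine (interp_antitone h ha (min_le_left t 0)).trans ?_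
  rw [interp_of_nonpos h a (min_le_right t 0)]
  exact hb 0

theorem interp_abs_deriv_le (h : IsSmoothStep H) {a : ℕ → ℝ} {D : ℝ}
    (ha : ∀ k, |a (k + 1) - a k| ≤ D) (t : ℝ) : |deriv (interp H a) t| ≤ 8 / 3 * D := by
  have hD : 0 ≤ D := (abs_nonneg _).trans (ha 0)
  obtain ⟨N, hN⟩ := exists_nat_gt t
  have heq : interp H a =ᶠ[𝓝 t] interpSum H a N := by
    filter_upwards [Iio_mem_nhds hN] with s hs
    exact interp_eq_interpSum h _ (le_of_lt hs)
  have hHd : Differentiable ℝ H := h.contDiff.differentiable (by simp)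
  have hd : HasDerivAt (interpSum H a N)
      (∑ k ∈ Finset.range N, (a (k + 1) - a k) * deriv H (t - k)) t := by
    unfold interpSum
    refine HasDerivAt.const_add _ (HasDerivAt.fun_sum fun k _ => HasDerivAt.const_mul _ ?_)
    exact (hHd (t - k)).hasDerivAt.comp_sub_const t (k : ℝ)
  rw [heq.deriv_eq, hd.deriv]
  by_cases hex : ∃ k ∈ Finset.range N, 0 < t - k ∧ t - k < 1
  · obtain ⟨k, hkN, hk0, hk1⟩ := hex
    rw [Finset.sum_eq_single_of_mem k hkN, abs_mul, mul_comm]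
    · exact mul_le_mul (h.abs_deriv_le _) (ha k) (abs_nonneg _) (by norm_num)
    · intro j _ hj
      rw [h.deriv_eq_zero, mul_zero]
      rcases lt_or_gt_of_ne hj with hjk | hjk
      · have : (j : ℝ) + 1 ≤ k := by exact_mod_cast hjk
        right; linarith
      · have : (k : ℝ) + 1 ≤ j := by exact_mod_cast hjk
        left; linarith
  · push Not at hex
    rw [Finset.sum_eq_zero, abs_zero]
    · positivity
    · intro k hk
      rw [h.deriv_eq_zero, mul_zero]
      rcases le_or_gt (t - k) 0 with hk0 | hk0
      · exact Or.inl hk0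
      · exact Or.inr (hex k hk hk0)

end TuringFlow

namespace TuringFlow

open Set Filter Topology
open scoped NNReal

/-! ### Global solutions of bounded locally Lipschitz fields -/

variable {E : Type*} [NormedAddCommGroup E] [NormedSpace ℝ E] [ProperSpace E]

theorem exists_integralCurve_of_bounded {Z : E → E} (hZ : LocallyLipschitz Z) {L : ℝ≥0}
    (hL : ∀ x, ‖Z x‖ ≤ L) (x₀ : E) :
    ∃ γ : ℝ → E, γ 0 = x₀ ∧ ∀ t, HasDerivAt γ (Z (γ t)) t := by
  have hlip : ∀ s : Set E, IsCompact s → ∃ K, LipschitzOnWith K Z s := fun s hs =>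
    (hZ.locallyLipschitzOn).exists_lipschitzOnWith_of_compact hs
  have hloc : ∀ n : ℕ, ∃ α : ℝ → E, α 0 = x₀ ∧
      ∀ t ∈ Icc (-(n : ℝ)) n, HasDerivWithinAt α (Z (α t)) (Icc (-(n : ℝ)) n) t := fun n => by
    obtain ⟨K, hK⟩ := hlip (Metric.closedBall x₀ (L * n : ℝ≥0)) (isCompact_closedBall _ _)
    have h0 : (0 : ℝ) ∈ Icc (-(n : ℝ)) n := by simp
    have hPL : IsPicardLindelof (fun _ => Z) (⟨0, h0⟩ : Icc (-(n : ℝ)) n) x₀ (L * n) 0 L K :=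
      IsPicardLindelof.of_time_independent (fun x _ => hL x) hK (by simp)
    exact hPL.exists_eq_forall_mem_Icc_hasDerivWithinAt₀
  choose α hα0 hα using hloc
  have hαd : ∀ n : ℕ, ∀ t ∈ Ioo (-(n : ℝ)) n, HasDerivAt (α n) (Z (α n t)) t := fun n t ht =>
    (hα n t (Ioo_subset_Icc_self ht)).hasDerivAt (Icc_mem_nhds ht.1 ht.2)
  have hαc : ∀ n : ℕ, IsCompact (α n '' Icc (-(n : ℝ)) n) := fun n =>
    isCompact_Icc.image_of_continuousOn fun t ht => (hα n t ht).continuousWithinAt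
  have hagree : ∀ n k : ℕ, 0 < n → n ≤ k → EqOn (α n) (α k) (Ioo (-(n : ℝ)) n) := by
    intro n k hn hnk
    have hn' : (0 : ℝ) < n := by exact_mod_cast hn
    have hnk' : (n : ℝ) ≤ k := by exact_mod_cast hnk
    have hsub : Ioo (-(n : ℝ)) n ⊆ Ioo (-(k : ℝ)) k := Ioo_subset_Ioo (by linarith) hnk'
    obtain ⟨K, hK⟩ := hlip _ ((hαc n).union (hαc k))
    refine ODE_solution_unique_of_mem_Ioo (v := fun _ => Z) (t₀ := 0) (fun _ _ => hK)
      ⟨by linarith, hn'⟩ (fun t ht => ⟨hαd n t ht, ?_⟩) (fun t ht => ⟨hαd k t (hsub ht), ?_⟩) ?_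
    · exact Or.inl ⟨t, Ioo_subset_Icc_self ht, rfl⟩
    · exact Or.inr ⟨t, Ioo_subset_Icc_self (hsub ht), rfl⟩
    · rw [hα0, hα0]
  let N : ℝ → ℕ := fun t => ⌊|t|⌋₊ + 1
  have hN : ∀ t, t ∈ Ioo (-(N t : ℝ)) (N t) := fun t => by
    have : |t| < N t := by
      simpa only [N, Nat.cast_add, Nat.cast_one] using Nat.lt_floor_add_one |t|
    exact abs_lt.1 this
  have hγ : ∀ (n : ℕ), ∀ t ∈ Ioo (-(n : ℝ)) n, α (N t) t = α n t := fun n t ht => by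
    have hnt : N t ≤ n := by
      have h := abs_lt.2 ht
      have : ⌊|t|⌋₊ < n := by
        rw [Nat.floor_lt (abs_nonneg t)]
        exact h
      exact this
    exact hagree _ _ (Nat.succ_pos _) hnt (hN t)
  refine ⟨fun t => α (N t) t, hα0 _, fun t => ?_⟩
  refine (hαd (N t) t (hN t)).congr_of_eventuallyEq ?_
  filter_upwards [Ioo_mem_nhds (hN t).1 (hN t).2] with s hs
  exact hγ _ s hs

end TuringFlow

namespace TuringFlow

open Set Filter Topology
open scoped ContDiff NNReal

/-! ### Trapping region around a channel -/

theorem channel_boundary_ineq {M h w A V : ℝ} (hM : 0 < M) (hh : |h| ≤ 4 / 3)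
    (hw : |w| ≤ 1 / 20) (hA : |A + 5 / 8 * M| ≤ M / 100)
    (hV : |V - (M + 5 / 8 * M * h)| ≤ M / 100) : A - h * V < 5 / 8 * (w * V) := by
  have hV' := abs_le.1 hV
  have hh' := abs_le.1 hh
  have h1 : |h * (V - (M + 5 / 8 * M * h))| ≤ 4 / 3 * (M / 100) := by
    rw [abs_mul]
    exact mul_le_mul hh hV (abs_nonneg _) (by norm_num)
  have h2 : |w * V| ≤ 1 / 20 * (2 * M) := by
    rw [abs_mul]
    refine mul_le_mul hw (abs_le.2 ⟨?_, ?_⟩) (abs_nonneg _) (by norm_num) <;> nlinarith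
  have h3 : 0 ≤ M * (h + 4 / 5) ^ 2 := by positivity
  have h1' := (abs_le.1 h1).1
  have h2' := (abs_le.1 h2).1
  have hA' := (abs_le.1 hA).2
  nlinarith

/-- The field `Z` follows, up to a relative error of one percent, the gradient of
`∫ W - (x - g y) ^ 2 / 2` in the channel `|x - g y| ≤ 5 / 8 * W y`. -/
structure IsChannel (Z : ℝ × ℝ → ℝ × ℝ) (W g : ℝ → ℝ) : Prop where
  width_diff : Differentiable ℝ W
  center_diff : Differentiable ℝ g
  width_pos : ∀ y, 0 < W y
  abs_deriv_width : ∀ y, |deriv W y| ≤ 1 / 20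
  abs_deriv_center : ∀ y, |deriv g y| ≤ 4 / 3
  fst_close : ∀ x y, |x - g y| ≤ 5 / 8 * W y → |(Z (x, y)).1 + (x - g y)| ≤ W y / 100
  snd_close : ∀ x y, |x - g y| ≤ 5 / 8 * W y →
    |(Z (x, y)).2 - (W y + (x - g y) * deriv g y)| ≤ W y / 100

variable {Z : ℝ × ℝ → ℝ × ℝ} {W g : ℝ → ℝ} {γ : ℝ → ℝ × ℝ}

theorem IsChannel.width_le_snd (hC : IsChannel Z W g) {x y : ℝ}
    (h : |x - g y| ≤ 5 / 8 * W y) : W y / 10 ≤ (Z (x, y)).2 := by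
  have h1 := (abs_le.1 (hC.snd_close x y h)).1
  have h2 : |(x - g y) * deriv g y| ≤ 5 / 8 * W y * (4 / 3) := by
    rw [abs_mul]
    exact mul_le_mul h (hC.abs_deriv_center y) (abs_nonneg _)
      (by linarith [hC.width_pos y])
  have := (abs_le.1 h2).1
  linarith [hC.width_pos y]

theorem hasDerivAt_fst (hγ : ∀ t, HasDerivAt γ (Z (γ t)) t) (t : ℝ) :
    HasDerivAt (fun t => (γ t).1) (Z (γ t)).1 t :=
  (hasFDerivAt_fst (𝕜 := ℝ) (p := γ t)).comp_hasDerivAt t (hγ t)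

theorem hasDerivAt_snd (hγ : ∀ t, HasDerivAt γ (Z (γ t)) t) (t : ℝ) :
    HasDerivAt (fun t => (γ t).2) (Z (γ t)).2 t :=
  (hasFDerivAt_snd (𝕜 := ℝ) (p := γ t)).comp_hasDerivAt t (hγ t)

theorem IsChannel.trapped (hC : IsChannel Z W g) (hγ : ∀ t, HasDerivAt γ (Z (γ t)) t)
    (h0 : (γ 0).1 = g (γ 0).2) {t : ℝ} (ht : 0 ≤ t) :
    |(γ t).1 - g (γ t).2| ≤ 5 / 8 * W (γ t).2 := by
  have hu : ∀ s, HasDerivAt (fun s => (γ s).1 - g (γ s).2)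
      ((Z (γ s)).1 - deriv g (γ s).2 * (Z (γ s)).2) s := fun s =>
    (hasDerivAt_fst hγ s).sub
      (((hC.center_diff _).hasDerivAt).comp s (hasDerivAt_snd hγ s))
  have hw : ∀ s, HasDerivAt (fun s => 5 / 8 * W (γ s).2)
      (5 / 8 * (deriv W (γ s).2 * (Z (γ s)).2)) s := fun s =>
    (((hC.width_diff _).hasDerivAt).comp s (hasDerivAt_snd hγ s)).const_mul _
  have hinit : 0 ≤ 5 / 8 * W (γ 0).2 := by linarith [hC.width_pos (γ 0).2]
  have hmem : t ∈ Icc 0 t := ⟨ht, le_rfl⟩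
  rw [abs_le']
  constructor
  · refine image_le_of_deriv_right_lt_deriv_boundary
      (fun s _ => (hu s).continuousAt.continuousWithinAt) (fun s _ => (hu s).hasDerivWithinAt)
      (by simpa [h0] using hinit) hw (fun s _ hs => ?_) hmem
    have hM := hC.width_pos (γ s).2
    have hin : |(γ s).1 - g (γ s).2| ≤ 5 / 8 * W (γ s).2 := by
      rw [hs, abs_of_nonneg (by linarith)]
    have hA := hC.fst_close _ _ hin
    have hV := hC.snd_close _ _ hin
    rw [hs] at hA hV
    exact channel_boundary_ineq hM (hC.abs_deriv_center _) (hC.abs_deriv_width _) hA hV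
  · refine image_le_of_deriv_right_lt_deriv_boundary
      (fun s _ => (hu s).neg.continuousAt.continuousWithinAt)
      (fun s _ => (hu s).neg.hasDerivWithinAt)
      (by simpa [h0] using hinit) hw (fun s _ hs => ?_) hmem
    have hM := hC.width_pos (γ s).2
    have hs' : (γ s).1 - g (γ s).2 = -(5 / 8 * W (γ s).2) := by
      rw [← hs]; simp
    have hin : |(γ s).1 - g (γ s).2| ≤ 5 / 8 * W (γ s).2 := by
      rw [hs', abs_neg, abs_of_nonneg (by linarith)]
    have hA := hC.fst_close _ _ hin
    have hV := hC.snd_close _ _ hin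
    rw [hs'] at hA hV
    have key := channel_boundary_ineq (A := -(Z (γ s)).1) (V := (Z (γ s)).2)
      (h := -deriv g (γ s).2) (w := deriv W (γ s).2) hM (by rw [abs_neg]; exact hC.abs_deriv_center _)
      (hC.abs_deriv_width _) (by rw [← abs_neg]; convert hA using 2; ring)
      (by convert hV using 2; ring)
    linarith

theorem exists_eq_of_speed_ge {y v : ℝ → ℝ} {W : ℝ → ℝ} (hy : ∀ t, HasDerivAt y (v t) t)
    (hW : Antitone W) (hpos : ∀ s, 0 < W s) (hv : ∀ t, 0 ≤ t → W (y t) / 10 ≤ v t)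
    (h0 : y 0 = 0) {N : ℝ} (hN : 0 ≤ N) : ∃ t, 0 ≤ t ∧ y t = N := by
  have hcont : Continuous y := continuous_iff_continuousAt.2 fun t => (hy t).continuousAt
  by_contra! hne
  have hlt : ∀ t, 0 ≤ t → y t < N := fun t ht => by
    by_contra! hge
    obtain ⟨s, hs, hsN⟩ := intermediate_value_Icc ht hcont.continuousOn
      (show N ∈ Icc (y 0) (y t) from ⟨by rw [h0]; exact hN, hge⟩)
    exact hne s hs.1 hsN
  set T := 10 * N / W N with hT
  have hT0 : 0 ≤ T := div_nonneg (by linarith) (hpos N).le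
  have hmvt := (convex_Icc 0 T).mul_sub_le_image_sub_of_le_deriv hcont.continuousOn
    (fun t _ => (hy t).differentiableAt.differentiableWithinAt) (C := W N / 10)
    (fun t ht => by
      rw [interior_Icc] at ht
      rw [(hy t).deriv]
      have := hW (hlt t ht.1.le).le
      linarith [hv t ht.1.le]) 0 ⟨le_rfl, hT0⟩ T ⟨hT0, le_rfl⟩ hT0
  have hTN : W N / 10 * (T - 0) = N := by
    have := (hpos N).ne'
    rw [hT]; field_simp; ring
  rw [hTN, h0] at hmvt
  linarith [hlt T hT0]

theorem IsChannel.exists_snd_eq (hC : IsChannel Z W g) (hW : Antitone W)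
    (hγ : ∀ t, HasDerivAt γ (Z (γ t)) t) (h0 : (γ 0).1 = g (γ 0).2) (h0' : (γ 0).2 = 0)
    {N : ℝ} (hN : 0 ≤ N) : ∃ t, 0 ≤ t ∧ (γ t).2 = N :=
  exists_eq_of_speed_ge (hasDerivAt_snd hγ) hW hC.width_pos
    (fun _ ht => hC.width_le_snd (hC.trapped hγ h0 ht)) h0' hN

/-- Truncation of a vector field to the square `[-5, 5] ^ 2`. -/
noncomputable def truncate (Y : ℝ × ℝ → ℝ × ℝ) (z : ℝ × ℝ) : ℝ × ℝ :=
  (max (-5) (min 5 (Y z).1), max (-5) (min 5 (Y z).2))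

theorem truncate_locallyLipschitz {Y : ℝ × ℝ → ℝ × ℝ} (hY : LocallyLipschitz Y) :
    LocallyLipschitz (truncate Y) := by
  have h : LipschitzWith (max 1 1) fun v : ℝ × ℝ => (max (-5) (min 5 v.1), max (-5) (min 5 v.2)) :=
    ((LipschitzWith.prod_fst.const_min 5).const_max (-5)).prodMk
      ((LipschitzWith.prod_snd.const_min 5).const_max (-5))
  exact h.locallyLipschitz.comp hY

theorem norm_truncate_le (Y : ℝ × ℝ → ℝ × ℝ) (z : ℝ × ℝ) : ‖truncate Y z‖ ≤ (5 : ℝ≥0) := by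
  have h : ∀ a : ℝ, |max (-5) (min 5 a)| ≤ 5 := fun a =>
    abs_le.2 ⟨le_max_left _ _, max_le (by norm_num) (min_le_left _ _)⟩
  exact max_le (h _) (h _)

theorem truncate_eq {Y : ℝ × ℝ → ℝ × ℝ} {z : ℝ × ℝ} (h1 : |(Y z).1| ≤ 5) (h2 : |(Y z).2| ≤ 5) :
    truncate Y z = Y z := by
  rw [abs_le] at h1 h2
  unfold truncate
  rw [min_eq_right h1.2, min_eq_right h2.2, max_eq_right h1.1, max_eq_right h2.1]

/-! ### The potential -/

theorem exists_antitone_le (e : ℕ → ℕ → ℝ) (he : ∀ i k, 0 < e i k) :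
    ∃ a : ℕ → ℝ, Antitone a ∧ (∀ n, 0 < a n) ∧ (∀ n, a n ≤ 1 / 64) ∧
      ∀ i k, a (i + k) ≤ e i k := by
  let S : ℕ → Finset (ℕ × ℕ) := fun n => Finset.range (n + 1) ×ˢ Finset.range (n + 1)
  let b : ℕ → ℝ := fun n => 64 + ∑ p ∈ S n, 1 / e p.1 p.2
  have hterm : ∀ p : ℕ × ℕ, 0 ≤ 1 / e p.1 p.2 := fun p => (one_div_pos.2 (he _ _)).le
  have hb64 : ∀ n, 64 ≤ b n := fun n =>
    le_add_of_nonneg_right (Finset.sum_nonneg fun p _ => hterm p)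
  have hb : ∀ n, 0 < b n := fun n => by linarith [hb64 n]
  refine ⟨fun n => 1 / b n, fun n k hnk => ?_, fun n => one_div_pos.2 (hb n), fun n => ?_,
    fun i k => ?_⟩
  · refine one_div_le_one_div_of_le (hb n) (add_le_add le_rfl ?_)
    refine Finset.sum_le_sum_of_subset_of_nonneg ?_ fun p _ _ => hterm p
    have : Finset.range (n + 1) ⊆ Finset.range (k + 1) := Finset.range_mono (by omega)
    exact Finset.product_subset_product this this
  · exact one_div_le_one_div_of_le (by norm_num) (hb64 n)
  · have hmem : (i, k) ∈ S (i + k) := by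
      simp only [S, Finset.mem_product, Finset.mem_range]
      omega
    have h1 := Finset.single_le_sum (f := fun p : ℕ × ℕ => 1 / e p.1 p.2) (fun p _ => hterm p) hmem
    have h2 : 1 / e i k ≤ b (i + k) := h1.trans (le_add_of_nonneg_left (by norm_num))
    exact (one_div_le (hb _) (he i k)).2 h2

/-- The potential guiding the flow in the strip number `i`. -/
noncomputable def stripPotential (F g : ℝ → ℝ) (i : ℕ) (z : ℝ × ℝ) : ℝ :=
  F (i + z.2) - (z.1 - g z.2) ^ 2 / 2

theorem grad2_stripPotential {F P g : ℝ → ℝ} (hF : ∀ t, HasDerivAt F (P t) t)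
    (hg : Differentiable ℝ g) (i : ℕ) (z : ℝ × ℝ) :
    grad2 (stripPotential F g i) z =
      (-(z.1 - g z.2), P (i + z.2) + (z.1 - g z.2) * deriv g z.2) := by
  have h1 := (hF (i + z.2)).comp_hasFDerivAt z
    ((hasFDerivAt_snd (𝕜 := ℝ) (p := z)).const_add (i : ℝ))
  have h2 := (hg z.2).hasDerivAt.comp_hasFDerivAt z (hasFDerivAt_snd (𝕜 := ℝ) (p := z))
  have h3 := (((hasFDerivAt_fst (𝕜 := ℝ) (p := z)).sub h2).pow 2).const_mul (1 / 2 : ℝ)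
  have h4 : HasFDerivAt (stripPotential F g i) _ z :=
    (h1.sub h3).congr_of_eventuallyEq (Eventually.of_forall fun w => by
      simp [stripPotential]; ring)
  unfold grad2
  rw [h4.fderiv]
  simp
  ring

/-- The channel centre in the strip number `i`, interpolating the values `2 * i + p i k`. -/
noncomputable def center (H : ℝ → ℝ) (p : ℕ → ℕ → ℝ) (i : ℕ) (y : ℝ) : ℝ :=
  2 * i + interp H (p i) y

/-- The potential glued from the potentials of all strips. -/
noncomputable def potential (H F : ℝ → ℝ) (p : ℕ → ℕ → ℝ) (z : ℝ × ℝ) : ℝ :=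
  interp H (fun i => stripPotential F (center H p i) i z) ((z.1 - 1 / 4) / 2)

variable {H : ℝ → ℝ}

theorem contDiff_interp (h : IsSmoothStep H) (a : ℕ → ℝ) : ContDiff ℝ ∞ (interp H a) :=
  interp_contDiff h (a := fun k _ => a k) (s := fun t => t) (fun _ => contDiff_const) contDiff_id

theorem contDiff_center (h : IsSmoothStep H) (p : ℕ → ℕ → ℝ) (i : ℕ) :
    ContDiff ℝ ∞ (center H p i) :=
  contDiff_const.add (contDiff_interp h _)

theorem contDiff_potential (h : IsSmoothStep H) {F : ℝ → ℝ} (hF : ContDiff ℝ ∞ F)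
    (p : ℕ → ℕ → ℝ) : ContDiff ℝ ∞ (potential H F p) := by
  refine interp_contDiff h (fun i => ?_) (by fun_prop)
  have := contDiff_center h p i
  unfold stripPotential
  fun_prop

theorem grad2_potential (h : IsSmoothStep H) (F : ℝ → ℝ) (p : ℕ → ℕ → ℝ) (i : ℕ) {z : ℝ × ℝ}
    (h1 : 2 * i - 1 / 4 < z.1) (h2 : z.1 < 2 * i + 3 / 4) :
    grad2 (potential H F p) z = grad2 (stripPotential F (center H p i) i) z := by
  have heq : potential H F p =ᶠ[𝓝 z] stripPotential F (center H p i) i := by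
    filter_upwards [continuous_fst.continuousAt.eventually (Ioo_mem_nhds h1 h2)] with w hw
    refine interp_of_near_nat h _ (abs_le.2 ?_)
    constructor <;> linarith [hw.1, hw.2]
  unfold grad2
  rw [heq.fderiv_eq]

theorem abs_fst_le_enorm2 (v : ℝ × ℝ) : |v.1| ≤ enorm2 v :=
  Real.abs_le_sqrt (by nlinarith [sq_nonneg v.2])

theorem abs_snd_le_enorm2 (v : ℝ × ℝ) : |v.2| ≤ enorm2 v :=
  Real.abs_le_sqrt (by nlinarith [sq_nonneg v.1])

end TuringFlow

namespace TuringFlow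

open Set Filter Topology
open scoped ContDiff NNReal

/-! ### Assembling the simulation -/

variable {H F P : ℝ → ℝ} {p : ℕ → ℕ → ℝ} {Y : ℝ × ℝ → ℝ × ℝ}

theorem center_mem_Icc (h : IsSmoothStep H) (hp : ∀ i k, 0 ≤ p i k ∧ p i k ≤ 1 / 2) (i : ℕ)
    (y : ℝ) : center H p i y ∈ Icc (2 * i : ℝ) (2 * i + 1 / 2) := by
  obtain ⟨k, θ, h0, h1, he⟩ := interp_exists_convex h (p i) y
  have ha := hp i k
  have hb := hp i (k + 1)
  unfold center
  rw [he]
  constructor <;> nlinarith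

theorem center_of_near_nat (h : IsSmoothStep H) (i : ℕ) {k : ℕ} {y : ℝ} (hy : |y - k| ≤ 1 / 4) :
    center H p i y = 2 * i + p i k := by
  rw [center, interp_of_near_nat h _ hy]

theorem abs_deriv_center_le (h : IsSmoothStep H) (hp : ∀ i k, 0 ≤ p i k ∧ p i k ≤ 1 / 2) (i : ℕ)
    (y : ℝ) : |deriv (center H p i) y| ≤ 4 / 3 := by
  have heq : deriv (center H p i) y = deriv (interp H (p i)) y := deriv_const_add _
  rw [heq]
  refine (interp_abs_deriv_le h (D := 1 / 2) (fun k => abs_le.2 ?_) y).trans (by norm_num)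
  have ha := hp i k
  have hb := hp i (k + 1)
  constructor <;> linarith

/-- A field close to the gradient of the potential is close, in the channel of the strip `i`, to
the gradient of the potential of that strip. -/
theorem perturbation_close (h : IsSmoothStep H) (hF : ∀ t, HasDerivAt F (P t) t)
    (hP : Antitone P) (hP1 : ∀ t, P t ≤ 1 / 64)
    (hp : ∀ i k, 0 ≤ p i k ∧ p i k ≤ 1 / 2)
    (hY : ∀ z, enorm2 (Y z - grad2 (potential H F p) z) ≤ P (|z.1| + |z.2|) / 100) (i : ℕ)
    {x y : ℝ} (hx : |x - center H p i y| ≤ 5 / 8 * P (i + y)) :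
    |(Y (x, y)).1 + (x - center H p i y)| ≤ P (i + y) / 100 ∧
      |(Y (x, y)).2 - (P (i + y) + (x - center H p i y) * deriv (center H p i) y)| ≤
        P (i + y) / 100 := by
  obtain ⟨hg0, hg1⟩ := center_mem_Icc h hp i y
  have hM := hP1 (i + y)
  obtain ⟨hx0, hx1⟩ := abs_le.1 hx
  have hle : (i : ℝ) + y ≤ |x| + |y| := by
    refine add_le_add ?_ (le_abs_self y)
    rcases Nat.eq_zero_or_pos i with rfl | hi
    · simp
    · have : (1 : ℝ) ≤ i := by exact_mod_cast hi
      exact le_trans (by linarith) (le_abs_self x)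
  have hη := (hY (x, y)).trans (div_le_div_of_nonneg_right (hP hle) (by norm_num))
  rw [grad2_potential h F p i (z := (x, y)) (by simp only; linarith) (by simp only; linarith),
    grad2_stripPotential hF ((contDiff_center h p i).differentiable (by simp))] at hη
  have h1 := (abs_fst_le_enorm2 _).trans hη
  have h2 := (abs_snd_le_enorm2 _).trans hη
  simp only [Prod.fst_sub, Prod.snd_sub, sub_neg_eq_add] at h1 h2
  exact ⟨h1, h2⟩
theorem truncate_eq_of_close {z : ℝ × ℝ} {M u v : ℝ} (hM : M ≤ 1 / 64) (hu : |u| ≤ 5 / 8 * M)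
    (hv : |v| ≤ 4 / 3) (h1 : |(Y z).1 + u| ≤ M / 100) (h2 : |(Y z).2 - (M + u * v)| ≤ M / 100) :
    truncate Y z = Y z := by
  have huv : |u * v| ≤ 5 / 8 * M * (4 / 3) := by
    rw [abs_mul]
    exact mul_le_mul hu hv (abs_nonneg _) ((abs_nonneg _).trans hu)
  rw [abs_le] at hu h1 h2 huv
  apply truncate_eq <;> rw [abs_le] <;> constructor <;> linarith

theorem mem_channel_of_mem_Uset {m : ℕ} {c : Config m} {z : ℝ × ℝ} (hz : z ∈ Uset (1 / 4) c) :
    ∃ j k : ℕ, |z.1 - (2 * j + phiEnc c)| < phiEnc c ^ 2 / 8 ∧ |z.2 - k| ≤ 1 / 4 := by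
  simp only [Uset, mem_iUnion, mem_prod, mem_Ioo] at hz
  obtain ⟨j, k, h1, h2⟩ := hz
  exact ⟨j, k, abs_lt.2 ⟨by linarith, by linarith⟩, abs_le.2 ⟨by linarith, by linarith⟩⟩

theorem mem_Uset_of_abs_sub_lt {m : ℕ} {c : Config m} {z : ℝ × ℝ} (j k : ℕ)
    (h1 : |z.1 - (2 * j + phiEnc c)| < phiEnc c ^ 2 / 8) (h2 : z.2 = k) :
    z ∈ Uset (1 / 4) c := by
  rw [abs_lt] at h1
  simp only [Uset, mem_iUnion, mem_prod, mem_Ioo]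
  exact ⟨j, k, ⟨by linarith, by linarith⟩, by linarith, by linarith⟩

theorem eq_of_abs_sub_encoding_lt {m : ℕ} {c c' : Config m} {i j : ℕ} {x : ℝ}
    (h : |x - (2 * i + phiEnc c)| < phiEnc c ^ 2 / 8)
    (h' : |x - (2 * j + phiEnc c')| < phiEnc c' ^ 2 / 8) : c = c' := by
  have hc := phiEnc_pos c
  have hc' := phiEnc_pos c'
  have hb := phiEnc_le_half c
  have hb' := phiEnc_le_half c'
  rw [abs_lt] at h h'
  have hij : i = j := by
    have h1 : (i : ℝ) < j + 1 := by nlinarith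
    have h2 : (j : ℝ) < i + 1 := by nlinarith
    have h3 : i < j + 1 := by exact_mod_cast h1
    have h4 : j < i + 1 := by exact_mod_cast h2
    omega
  subst hij
  exact eq_of_abs_phiEnc_sub_lt (abs_lt.2 ⟨by linarith, by linarith⟩)

/-- The bound on the channel widths: a decreasing sequence whose terms `a (i + k)` are small
compared to the squares of the positions `p i k`. -/
theorem exists_width (hp : ∀ i k, 0 < p i k) :
    ∃ a : ℕ → ℝ, Antitone a ∧ (∀ n, 0 < a n) ∧ (∀ n, a n ≤ 1 / 64) ∧
      ∀ i k, 5 / 8 * a (i + k) < p i k ^ 2 / 8 := by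
  obtain ⟨a, h1, h2, h3, h4⟩ := exists_antitone_le (fun i k => p i k ^ 2 / 8)
    fun i k => by have := hp i k; positivity
  exact ⟨a, h1, h2, h3, fun i k => by linarith [h4 i k, h2 (i + k)]⟩

/-- Integral curves, starting on the centre of the channel of the strip `i`, of a field close to
the gradient of the potential: they stay in the channel and reach every height. -/
theorem exists_channel_curve (h : IsSmoothStep H) {a : ℕ → ℝ} (ha : Antitone a)
    (ha0 : ∀ n, 0 < a n) (ha1 : ∀ n, a n ≤ 1 / 64) (hF : ∀ t, HasDerivAt F (interp H a t) t)
    (hp : ∀ i k, 0 ≤ p i k ∧ p i k ≤ 1 / 2) (hYlip : LocallyLipschitz Y)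
    (hY : ∀ z, enorm2 (Y z - grad2 (potential H F p) z) ≤ interp H a (|z.1| + |z.2|) / 100)
    (i : ℕ) :
    ∃ γ : ℝ → ℝ × ℝ, γ 0 = (2 * i + p i 0, 0) ∧ (∀ t, 0 ≤ t → HasDerivAt γ (Y (γ t)) t) ∧
      (∀ t, 0 ≤ t → |(γ t).1 - center H p i (γ t).2| ≤ 5 / 8 * interp H a (i + (γ t).2)) ∧
      ∀ k : ℕ, ∃ t, 0 ≤ t ∧ (γ t).2 = k := by
  have hP := interp_antitone h ha
  have hP0 := interp_pos h ha ha0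
  have hP1 := interp_le h ha ha1
  have hdiff : Differentiable ℝ (interp H a) := (contDiff_interp h a).differentiable (by simp)
  have htr : ∀ x y, |x - center H p i y| ≤ 5 / 8 * interp H a (i + y) →
      truncate Y (x, y) = Y (x, y) := fun x y hx => by
    obtain ⟨h1, h2⟩ := perturbation_close h hF hP hP1 hp hY i hx
    exact truncate_eq_of_close (hP1 _) hx (abs_deriv_center_le h hp i y) h1 h2
  have hC : IsChannel (truncate Y) (fun y => interp H a (i + y)) (center H p i) :=
    { width_diff := hdiff.comp (differentiable_id.const_add _)
      center_diff := (contDiff_center h p i).differentiable (by simp)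
      width_pos := fun y => hP0 _
      abs_deriv_width := fun y => by
        rw [deriv_comp_const_add]
        refine (interp_abs_deriv_le h (D := 1 / 64) (fun k => abs_le.2 ?_) _).trans (by norm_num)
        constructor <;> linarith [ha0 k, ha1 k, ha0 (k + 1), ha1 (k + 1)]
      abs_deriv_center := abs_deriv_center_le h hp i
      fst_close := fun x y hx => by
        rw [htr x y hx]
        exact (perturbation_close h hF hP hP1 hp hY i hx).1
      snd_close := fun x y hx => by
        rw [htr x y hx]
        exact (perturbation_close h hF hP hP1 hp hY i hx).2 }
  obtain ⟨γ, hγ0, hγ⟩ := exists_integralCurve_of_bounded (truncate_locallyLipschitz hYlip)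
    (norm_truncate_le Y) ((2 * i + p i 0, 0) : ℝ × ℝ)
  have h0 : (γ 0).1 = center H p i (γ 0).2 := by
    rw [hγ0, center_of_near_nat h i (k := 0) (by simp)]
  have htrap := fun (t : ℝ) (ht : 0 ≤ t) => hC.trapped hγ h0 ht
  refine ⟨γ, hγ0, fun t ht => ?_, htrap, fun k => ?_⟩
  · have := hγ t
    rwa [← Prod.mk.eta (p := γ t), htr _ _ (htrap t ht)] at this
  · exact hC.exists_snd_eq (fun y z hyz => hP (add_le_add_right hyz _)) hγ h0 (by rw [hγ0])
      k.cast_nonneg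

end TuringFlow

/-- Robust simulation: there are a smooth `f : ℝ² → ℝ` and a continuous positive
error bound `η` such that every locally Lipschitz vector field `Y` with
`|Y − ∇f| ≤ η` pointwise still simulates the Turing machine `T` along its integral
curves starting at the points `p_{cᵢ}`. -/
theorem statement9 (m : ℕ) (hm : 2 ≤ m) (T : TuringMachine m) (tape : ℕ ≃ Tape) :
    ∃ (ε₀ : ℝ) (f : ℝ × ℝ → ℝ) (η : ℝ × ℝ → ℝ),
      0 < ε₀ ∧ ContDiff ℝ (⊤ : ℕ∞) f ∧ Continuous η ∧ (∀ x, 0 < η x) ∧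
      ∀ Y : ℝ × ℝ → ℝ × ℝ, LocallyLipschitz Y →
        (∀ x, enorm2 (Y x - grad2 f x) ≤ η x) →
        ∀ i : ℕ, ∃ γ : ℝ → ℝ × ℝ,
          γ 0 = (2 * (i : ℝ) + phiEnc ((T.q0, tape i) : Config m), 0) ∧
          (∀ t : ℝ, 0 ≤ t → HasDerivAt γ (Y (γ t)) t) ∧
          ∀ c : Config m,
            (∃ t : ℝ, 0 ≤ t ∧ γ t ∈ Uset ε₀ c) ↔
              ∃ k : ℕ, T.step^[k] (T.q0, tape i) = c := by
  obtain ⟨H, h⟩ := TuringFlow.exists_isSmoothStep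
  set p : ℕ → ℕ → ℝ := fun i k => phiEnc (T.step^[k] (T.q0, tape i)) with hp_def
  have hp0 : ∀ i k, 0 < p i k := fun i k => TuringFlow.phiEnc_pos _
  have hp : ∀ i k, 0 ≤ p i k ∧ p i k ≤ 1 / 2 := fun i k =>
    ⟨(hp0 i k).le, TuringFlow.phiEnc_le_half _⟩
  obtain ⟨a, ha, ha0, ha1, hap⟩ := TuringFlow.exists_width hp0
  set P := TuringFlow.interp H a with hP_def
  have hPs : ContDiff ℝ (⊤ : ℕ∞) P := TuringFlow.contDiff_interp h a
  set F : ℝ → ℝ := fun t => ∫ s in (0 : ℝ)..t, P s with hF_def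
  have hF : ∀ t, HasDerivAt F (P t) t := fun t =>
    intervalIntegral.integral_hasDerivAt_right (hPs.continuous.intervalIntegrable _ _)
      (hPs.continuous.stronglyMeasurableAtFilter _ _) hPs.continuous.continuousAt
  refine ⟨1 / 4, TuringFlow.potential H F p, fun z => P (|z.1| + |z.2|) / 100, by norm_num,
    TuringFlow.contDiff_potential h (TuringFlow.contDiff_integral hPs 0) p,
    (hPs.continuous.comp (by fun_prop)).div_const _,
    fun z => div_pos (TuringFlow.interp_pos h ha ha0 _) (by norm_num), fun Y hYlip hY i => ?_⟩
  obtain ⟨γ, hγ0, hγ, htrap, hreach⟩ :=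
    TuringFlow.exists_channel_curve h ha ha0 ha1 hF hp hYlip hY i
  have hpos : ∀ t, 0 ≤ t → ∀ k : ℕ, |(γ t).2 - k| ≤ 1 / 4 →
      |(γ t).1 - (2 * i + p i k)| < p i k ^ 2 / 8 := fun t ht k hk => by
    have h1 := htrap t ht
    rw [TuringFlow.center_of_near_nat h i hk, TuringFlow.interp_of_near_nat h a (k := i + k)
      (by push_cast; rwa [add_sub_add_left_eq_sub])] at h1
    exact h1.trans_lt (hap i k)
  refine ⟨γ, hγ0, hγ, fun c => ⟨?_, ?_⟩⟩
  · rintro ⟨t, ht, hmem⟩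
    obtain ⟨j, k, hj, hk⟩ := TuringFlow.mem_channel_of_mem_Uset hmem
    exact ⟨k, TuringFlow.eq_of_abs_sub_encoding_lt (hpos t ht k hk) hj⟩
  · rintro ⟨k, rfl⟩
    obtain ⟨t, ht, hk⟩ := hreach k
    exact ⟨t, ht, TuringFlow.mem_Uset_of_abs_sub_lt i k (hpos t ht k (by simp [hk])) hk⟩
end
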